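/- Let q⃗ = (q₁,q₂,q₃) with q_j ∈ [2,∞) for each j, and let m ∈ [2,∞] satisfy 2/m + 1/q̄ = 3/2, where 1/q̄ := 1/q₁+1/q₂+1/q₃. There exists a constant C, depending only on q⃗, such that for every ϱ > 0 and every f : ℝ³×(−2ϱ²,0) → ℝ that is smooth in the spatial variable and satisfies ∫_{B(√2 ϱ)} f(x,t) dx = 0 for a.e. t: ‖f‖_{L^m_t L^{q⃗}_x(Q(ϱ))} ≤ C · ‖∇f‖_{L²(Q(√2 ϱ))}^{2/m} · ‖f‖_{L^∞_t L²_x(Q(√2 ϱ))}^{1 − 2/m}. -/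

import Mathlib

open MeasureTheory ENNReal Set Metric Filter

noncomputable section

/-- Euclidean 3-space. -/
abbrev E3 : Type := EuclideanSpace ℝ (Fin 3)

/-- The point (x₁,x₂,x₃) of ℝ³. -/
def pt3 (x1 x2 x3 : ℝ) : E3 := (WithLp.equiv 2 (Fin 3 → ℝ)).symm ![x1, x2, x3]

/-- Anisotropic Lebesgue (quasi-)norm `‖f‖_{L^{q⃗}(Ω)}` with finite exponents:
iterated L^{q₁}, L^{q₂}, L^{q₃} norms in x₁, x₂, x₃ of f extended by 0 outside Ω. -/
def anisoNorm (q1 q2 q3 : ℝ) (Ω : Set E3) (f : E3 → ℝ) : ℝ≥0∞ :=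
  (∫⁻ x3 : ℝ, (∫⁻ x2 : ℝ, (∫⁻ x1 : ℝ,
      (ENNReal.ofReal |Ω.indicator f (pt3 x1 x2 x3)|) ^ q1) ^ (q2 / q1)) ^ (q3 / q2)) ^ (1 / q3)

/-- Partial derivative in the i-th coordinate direction. -/
def pd (i : Fin 3) (f : E3 → ℝ) (x : E3) : ℝ := fderiv ℝ f x (EuclideanSpace.single i 1)

/-- Laplacian. -/
def lap (f : E3 → ℝ) (x : E3) : ℝ := ∑ i : Fin 3, pd i (fun y => pd i f y) x

/-- Mixed norm `‖f‖_{L^p_t L^{q⃗}_x(Q(r))}`, time exponent `p ∈ [1,∞]`,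
where `Q(r) = B(r) × (−r²,0)`. -/
def mixedNorm (p : ℝ≥0∞) (q1 q2 q3 r : ℝ) (f : E3 → ℝ → ℝ) : ℝ≥0∞ :=
  if p = ∞ then
    essSup (fun t => anisoNorm q1 q2 q3 (ball (0 : E3) r) (fun x => f x t))
      (volume.restrict (Ioo (-(r^2)) 0))
  else
    (∫⁻ t in Ioo (-(r^2)) 0,
        (anisoNorm q1 q2 q3 (ball (0 : E3) r) (fun x => f x t)) ^ p.toReal) ^ (1 / p.toReal)

/-- `L²` norm of a scalar function over a set. -/
def l2On (s : Set E3) (g : E3 → ℝ) : ℝ≥0∞ :=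
  (∫⁻ x in s, (ENNReal.ofReal |g x|) ^ 2) ^ ((1:ℝ)/2)

/-- One-dimensional Riesz kernel. -/
def rk (b : ℝ) (z : ℝ) : ℝ≥0∞ := (ENNReal.ofReal |z|) ^ (-b)

theorem measurable_rk (b : ℝ) : Measurable (rk b) := by
  unfold rk; fun_prop

theorem lint_abs (g : ℝ → ℝ≥0∞) :
    ∫⁻ z : ℝ, g |z| = 2 * ∫⁻ z in Ioi (0:ℝ), g z := by
  have h1 : ∫⁻ z : ℝ, g |z| = (∫⁻ z in Iic (0:ℝ), g |z|) + ∫⁻ z in Ioi (0:ℝ), g |z| := by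
    rw [← lintegral_add_compl _ (measurableSet_Iic (a := (0:ℝ))), compl_Iic]
  have h2 : ∫⁻ z in Ioi (0:ℝ), g |z| = ∫⁻ z in Ioi (0:ℝ), g z :=
    setLIntegral_congr_fun measurableSet_Ioi (fun z hz => by
      rw [abs_of_pos (by exact hz)])
  have h3 : ∫⁻ z in Iic (0:ℝ), g |z| = ∫⁻ z in Ioi (0:ℝ), g |z| := by
    have := (Measure.measurePreserving_neg (volume : Measure ℝ)).setLIntegral_comp_preimage_emb
      (MeasurableEquiv.neg ℝ).measurableEmbedding (fun z => g |z|) (Iic (0:ℝ))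
    rw [← this]
    simp only [abs_neg]
    have hh : (Neg.neg ⁻¹' (Iic (0:ℝ))) = Ici 0 := by ext z; simp
    rw [hh]
    exact setLIntegral_congr Ioi_ae_eq_Ici.symm
  rw [h1, h3, h2, two_mul]

theorem lint_near {b R : ℝ} (hb : b < 1) (hR : 0 < R) :
    ∫⁻ z in {z : ℝ | |z| < R}, rk b z
      = ENNReal.ofReal (2 / (1 - b)) * (ENNReal.ofReal R) ^ (1 - b) := by
  have hm : MeasurableSet {z : ℝ | |z| < R} := measurableSet_lt (by fun_prop) (by fun_prop)
  rw [← lintegral_indicator hm]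
  have e : ∀ z : ℝ, ({z : ℝ | |z| < R}.indicator (rk b) z)
      = (fun s : ℝ => (Iio R).indicator (fun s => (ENNReal.ofReal s) ^ (-b)) s) |z| := by
    intro z
    by_cases h : |z| < R <;> simp [indicator, h, rk]
  simp_rw [e]
  rw [lint_abs, lintegral_indicator measurableSet_Iio, Measure.restrict_restrict measurableSet_Iio,
    Iio_inter_Ioi]
  have i1 : IntegrableOn (fun s : ℝ => s ^ (-b)) (Ioo 0 R) := by
    have := (intervalIntegral.intervalIntegrable_rpow' (r := -b) (a := 0) (b := R) (by linarith))
    rw [intervalIntegrable_iff_integrableOn_Ioo_of_le hR.le] at this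
    exact this
  have i2 : ∫ s in Ioo 0 R, s ^ (-b) = R ^ (1 - b) / (1 - b) := by
    rw [← integral_Ioc_eq_integral_Ioo, ← intervalIntegral.integral_of_le hR.le,
      integral_rpow (Or.inl (by linarith))]
    rw [Real.zero_rpow (by linarith), sub_zero]
    congr 1 <;> ring_nf
  have i3 : ∫⁻ s in Ioo 0 R, (ENNReal.ofReal s) ^ (-b) = ENNReal.ofReal (R ^ (1 - b) / (1 - b)) := by
    rw [← i2, ofReal_integral_eq_lintegral_ofReal i1]
    · refine setLIntegral_congr_fun measurableSet_Ioo (fun s hs => ?_)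
      exact ENNReal.ofReal_rpow_of_pos hs.1
    · filter_upwards [ae_restrict_mem measurableSet_Ioo] with s hs
      exact Real.rpow_nonneg hs.1.le _
  rw [i3, ENNReal.ofReal_rpow_of_pos hR, ← ENNReal.ofReal_mul (by apply div_nonneg <;> linarith),
    show (2:ℝ≥0∞) = ENNReal.ofReal 2 by simp, ← ENNReal.ofReal_mul (by norm_num)]
  congr 1; ring

theorem lint_far {b R : ℝ} (hb : 1 < b) (hR : 0 < R) :
    ∫⁻ z in {z : ℝ | |z| < R}ᶜ, rk b z
      = ENNReal.ofReal (2 / (b - 1)) * (ENNReal.ofReal R) ^ (1 - b) := by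
  have hm : MeasurableSet {z : ℝ | |z| < R} := measurableSet_lt (by fun_prop) (by fun_prop)
  rw [← lintegral_indicator hm.compl]
  have e : ∀ z : ℝ, ({z : ℝ | |z| < R}ᶜ.indicator (rk b) z)
      = (fun s : ℝ => (Ici R).indicator (fun s => (ENNReal.ofReal s) ^ (-b)) s) |z| := by
    intro z
    by_cases h : |z| < R
    · simp [indicator, h]
    · simp [indicator, h, rk, not_lt.1 h]
  simp_rw [e]
  rw [lint_abs, lintegral_indicator measurableSet_Ici, Measure.restrict_restrict measurableSet_Ici,
    inter_eq_left.2 (Ici_subset_Ioi.2 hR), ← setLIntegral_congr Ioi_ae_eq_Ici]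
  have i3 : ∫⁻ s in Ioi R, (ENNReal.ofReal s) ^ (-b) = ENNReal.ofReal (R ^ (1 - b) / (b - 1)) := by
    have := integral_Ioi_rpow_of_lt (a := -b) (by linarith) hR
    rw [show R ^ (1 - b) / (b - 1) = -R ^ (-b + 1) / (-b + 1) by
      rw [show -b + 1 = -(b - 1) by ring, neg_div_neg_eq]; ring_nf, ← this,
      ofReal_integral_eq_lintegral_ofReal (integrableOn_Ioi_rpow_of_lt (by linarith) hR)]
    · refine setLIntegral_congr_fun measurableSet_Ioi (fun s hs => ?_)
      exact ENNReal.ofReal_rpow_of_pos (hR.trans hs)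
    · filter_upwards [ae_restrict_mem measurableSet_Ioi] with s hs
      exact Real.rpow_nonneg (hR.trans hs).le _
  rw [i3, ENNReal.ofReal_rpow_of_pos hR, ← ENNReal.ofReal_mul (by apply div_nonneg <;> linarith),
    show (2:ℝ≥0∞) = ENNReal.ofReal 2 by simp, ← ENNReal.ofReal_mul (by norm_num)]
  congr 1; ring

/-- Cauchy-Schwarz. -/
theorem lint_cs {Y : Type*} [MeasurableSpace Y] (ν : Measure Y) {f g : Y → ℝ≥0∞}
    (hf : Measurable f) (hg : Measurable g) :
    ∫⁻ y, f y * g y ∂ν ≤ (∫⁻ y, f y ^ 2 ∂ν) ^ ((1:ℝ)/2) * (∫⁻ y, g y ^ 2 ∂ν) ^ ((1:ℝ)/2) := by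
  have := ENNReal.lintegral_mul_le_Lp_mul_Lq ν (p := 2) (q := 2)
    Real.HolderConjugate.two_two hf.aemeasurable hg.aemeasurable
  simpa using this

/-- Minkowski integral inequality for L². -/
theorem lint_mink {X Y : Type*} [MeasurableSpace X] [MeasurableSpace Y] (μ : Measure X)
    (ν : Measure Y) [SFinite μ] [SFinite ν] {F : X → Y → ℝ≥0∞}
    (hF : Measurable (Function.uncurry F)) :
    (∫⁻ y, (∫⁻ x, F x y ∂μ) ^ 2 ∂ν) ^ ((1:ℝ)/2) ≤ ∫⁻ x, (∫⁻ y, F x y ^ 2 ∂ν) ^ ((1:ℝ)/2) ∂μ := by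
  have hFx : ∀ y, Measurable (fun x => F x y) := fun y => hF.comp (by fun_prop : Measurable fun x => (x, y))
  have hFy : ∀ x, Measurable (fun y => F x y) := fun x => hF.comp (by fun_prop : Measurable fun y => (x, y))
  set N : X → ℝ≥0∞ := fun x => (∫⁻ y, F x y ^ 2 ∂ν) ^ ((1:ℝ)/2) with hN
  have hNm : Measurable N := by
    refine Measurable.pow_const ?_ _
    exact Measurable.lintegral_prod_right' (f := fun p : X × Y => F p.1 p.2 ^ 2) (hF.pow_const 2)
  have key : ∫⁻ y, (∫⁻ x, F x y ∂μ) ^ 2 ∂ν ≤ (∫⁻ x, N x ∂μ) ^ 2 := by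
    calc ∫⁻ y, (∫⁻ x, F x y ∂μ) ^ 2 ∂ν
        = ∫⁻ y, ∫⁻ x, ∫⁻ x', F x y * F x' y ∂μ ∂μ ∂ν := by
          refine lintegral_congr fun y => ?_
          rw [sq, ← lintegral_mul_const _ (hFx y)]
          refine lintegral_congr fun x => ?_
          rw [lintegral_const_mul _ (hFx y)]
      _ = ∫⁻ x, ∫⁻ y, ∫⁻ x', F x y * F x' y ∂μ ∂ν ∂μ := by
          rw [lintegral_lintegral_swap]
          refine Measurable.aemeasurable ?_
          refine Measurable.lintegral_prod_right' (f := fun p : (Y × X) × X => F p.1.2 p.1.1 * F p.2 p.1.1) ?_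
          exact (hF.comp (by fun_prop : Measurable fun p : (Y × X) × X => (p.1.2, p.1.1))).mul
            (hF.comp (by fun_prop : Measurable fun p : (Y × X) × X => (p.2, p.1.1)))
      _ = ∫⁻ x, ∫⁻ x', ∫⁻ y, F x y * F x' y ∂ν ∂μ ∂μ := by
          refine lintegral_congr fun x => ?_
          rw [lintegral_lintegral_swap]
          refine Measurable.aemeasurable ?_
          exact (hF.comp (by fun_prop : Measurable fun p : (Y × X) => (x, p.1))).mul
            (hF.comp (by fun_prop : Measurable fun p : (Y × X) => (p.2, p.1)))
      _ ≤ ∫⁻ x, ∫⁻ x', N x * N x' ∂μ ∂μ := by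
          gcongr with x x'
          exact lint_cs ν (hFy x) (hFy x')
      _ = (∫⁻ x, N x ∂μ) ^ 2 := by
          rw [sq, ← lintegral_mul_const _ hNm]
          refine lintegral_congr fun x => ?_
          rw [lintegral_const_mul _ hNm]
  calc _ ≤ ((∫⁻ x, N x ∂μ) ^ 2) ^ ((1:ℝ)/2) := by gcongr
    _ = _ := by
      rw [← ENNReal.rpow_natCast, ← ENNReal.rpow_mul]; simp

theorem trunc0 {a α : ℝ} (ha : 1 < a) (hα1 : α < 1) (hexp : 0 < 1 - a * (1 - α)) :
    ∃ C : ℝ≥0∞, C ≠ ⊤ ∧ C ≠ 0 ∧ ∀ v : ℝ → ℝ≥0∞, Measurable v → ∫⁻ z, v z ^ a ≤ 1 → ∀ B : ℝ≥0∞,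
      ∫⁻ z, min (v z) B * rk α z ≤ C * B ^ (1 - a * (1 - α)) := by
  set a' := a.conjExponent with ha'
  have hpq : a.HolderConjugate a' := Real.HolderConjugate.conjExponent ha
  have ha'0 : 0 < a' := hpq.symm.pos
  have haa : a / a' = a - 1 := by
    rw [ha', Real.conjExponent]
    have : a - 1 ≠ 0 := by linarith
    have : a ≠ 0 := by linarith
    field_simp
  have hαa : 1 < α * a' := by
    have h1 : a - 1 < a * α := by linarith
    have h2 : a = (a - 1) * a' := by rw [← haa]; field_simp
    have h3 : a * α = (a - 1) * (α * a') := by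
      calc a * α = ((a - 1) * a') * α := by rw [← h2]
        _ = _ := by ring
    rw [h3] at h1
    have : (a - 1) * 1 < (a - 1) * (α * a') := by linarith
    exact lt_of_mul_lt_mul_left this (by linarith)
  refine ⟨ENNReal.ofReal (2 / (1 - α)) + ENNReal.ofReal (2 / (α * a' - 1)) ^ (1 / a'), ?_, ?_, ?_⟩
  · refine ENNReal.add_ne_top.2 ⟨ENNReal.ofReal_ne_top, ?_⟩
    exact ENNReal.rpow_ne_top_of_nonneg (by positivity) ENNReal.ofReal_ne_top
  · have : 0 < ENNReal.ofReal (2 / (1 - α)) := by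
      rw [ENNReal.ofReal_pos]; apply div_pos <;> linarith
    exact (lt_of_lt_of_le this le_self_add).ne'
  intro v hv hv1 B
  rcases eq_or_ne B 0 with rfl | hB0
  · simp
  rcases eq_or_ne B ⊤ with rfl | hBt
  · rw [ENNReal.top_rpow_of_pos hexp, ENNReal.mul_top]
    · exact le_top
    · have : 0 < ENNReal.ofReal (2 / (1 - α)) := by
        rw [ENNReal.ofReal_pos]; apply div_pos <;> linarith
      exact (lt_of_lt_of_le this le_self_add).ne'
  have hb : 0 < B.toReal := ENNReal.toReal_pos hB0 hBt
  set R : ℝ := B.toReal ^ (-a) with hR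
  have hR0 : 0 < R := Real.rpow_pos_of_pos hb _
  have hRB : ENNReal.ofReal R = B ^ (-a) := by
    rw [hR, ← ENNReal.ofReal_rpow_of_pos hb, ENNReal.ofReal_toReal hBt]
  have hm : MeasurableSet {z : ℝ | |z| < R} := measurableSet_lt (by fun_prop) (by fun_prop)
  rw [← lintegral_add_compl _ hm, add_mul]
  gcongr
  · calc ∫⁻ z in {z : ℝ | |z| < R}, min (v z) B * rk α z
        ≤ ∫⁻ z in {z : ℝ | |z| < R}, B * rk α z := by gcongr; exact min_le_right _ _
      _ = B * (ENNReal.ofReal (2 / (1 - α)) * (B ^ (-a)) ^ (1 - α)) := by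
          rw [lintegral_const_mul _ (measurable_rk α), lint_near hα1 hR0, hRB]
      _ = ENNReal.ofReal (2 / (1 - α)) * B ^ (1 - a * (1 - α)) := by
          rw [← ENNReal.rpow_mul, show 1 - a * (1 - α) = 1 + -a * (1 - α) by ring,
            ENNReal.rpow_add _ _ hB0 hBt, ENNReal.rpow_one]
          ring
      _ ≤ _ := le_rfl
  · calc ∫⁻ z in {z : ℝ | |z| < R}ᶜ, min (v z) B * rk α z
        ≤ ∫⁻ z in {z : ℝ | |z| < R}ᶜ, v z * rk α z := by gcongr; exact min_le_left _ _
      _ ≤ (∫⁻ z in {z : ℝ | |z| < R}ᶜ, v z ^ a) ^ (1 / a) *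
            (∫⁻ z in {z : ℝ | |z| < R}ᶜ, rk α z ^ a') ^ (1 / a') :=
          ENNReal.lintegral_mul_le_Lp_mul_Lq _ hpq hv.aemeasurable (measurable_rk α).aemeasurable
      _ ≤ 1 * (∫⁻ z in {z : ℝ | |z| < R}ᶜ, rk (α * a') z) ^ (1 / a') := by
          gcongr
          · refine ENNReal.rpow_le_one ?_ (by positivity)
            exact (setLIntegral_le_lintegral _ _).trans hv1
          · rw [rk, rk, ← ENNReal.rpow_mul]
            apply le_of_eq; congr 1; ring
      _ = _ := by
          rw [one_mul, lint_far hαa hR0, hRB, ENNReal.mul_rpow_of_nonneg _ _ (by positivity)]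
          congr 1
          rw [← ENNReal.rpow_mul, ← ENNReal.rpow_mul]
          congr 1
          have : -a * ((1 - α * a') * (1 / a')) = -(a / a') + a * α := by field_simp; ring
          rw [this, haa]; ring

theorem trunc {a α : ℝ} (ha : 1 < a) (hα1 : α < 1) (hexp : 0 < 1 - a * (1 - α)) :
    ∃ C : ℝ≥0∞, C ≠ ⊤ ∧ C ≠ 0 ∧ ∀ v : ℝ → ℝ≥0∞, Measurable v → ∫⁻ z, v z ^ a ≤ 1 → ∀ B : ℝ≥0∞, ∀ x,
      ∫⁻ y, min (v y) B * rk α (x - y) ≤ C * B ^ (1 - a * (1 - α)) := by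
  obtain ⟨C, hC, hC0, h⟩ := trunc0 ha hα1 hexp
  refine ⟨C, hC, hC0, fun v hv hv1 B x => ?_⟩
  have := h (fun z => v (x - z)) (hv.comp (by fun_prop))
    (by rw [lintegral_sub_left_eq_self (fun z => v z ^ a)]; exact hv1) B
  rw [← lintegral_sub_left_eq_self (fun z => min (v (x - z)) B * rk α z) x] at this
  simpa using this

theorem rk_symm (α x y : ℝ) : rk α (x - y) = rk α (y - x) := by
  rw [rk, rk, abs_sub_comm]

/-- bilinear HLS -/
theorem hls_bilin {q : ℝ} (hq : 2 < q) :
    ∃ C : ℝ≥0∞, C ≠ ⊤ ∧ C ≠ 0 ∧ ∀ f g : ℝ → ℝ≥0∞, Measurable f → Measurable g →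
      ∫⁻ z, f z ^ (2:ℝ) ≤ 1 → ∫⁻ z, g z ^ (q / (q - 1)) ≤ 1 →
      ∫⁻ x, ∫⁻ y, rk (1/2 + 1/q) (x - y) * f y * g x ≤ C := by
  set α := 1/2 + 1/q with hα
  set p := q / (q - 1) with hp
  have hq1 : q - 1 ≠ 0 := by linarith
  have hq0 : q ≠ 0 := by linarith
  have hp1 : 1 < p := by rw [hp, lt_div_iff₀ (by linarith)]; linarith
  have hiq : 1 / q < 1 / 2 := one_div_lt_one_div_of_lt (by norm_num) hq
  have hiq0 : 0 < 1 / q := by apply div_pos <;> linarith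
  have e1 : 1 - 2 * (1 - α) = 2 / q := by rw [hα]; ring
  have e2 : 1 - p * (1 - α) = p / 2 := by rw [hα, hp]; field_simp; ring
  obtain ⟨C1, hC1, hC10, h1⟩ := trunc (a := 2) (α := α) (by norm_num) (by rw [hα]; linarith)
    (by rw [e1]; apply div_pos <;> linarith)
  obtain ⟨C2, hC2, hC20, h2⟩ := trunc (a := p) (α := α) hp1 (by rw [hα]; linarith)
    (by rw [e2]; linarith)
  rw [e1] at h1; rw [e2] at h2
  refine ⟨C1 + C2, by simp [hC1, hC2], by simp [hC10], fun f g hf hg hf1 hg1 => ?_⟩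
  have hp0 : 0 < p := by linarith
  have hrk1 := measurable_rk α
  have hrk : Measurable (fun z : ℝ × ℝ => rk α (z.1 - z.2)) := (measurable_rk α).comp (by fun_prop)
  have pw : ∀ x y, rk α (x - y) * f y * g x ≤ min (f y) (g x ^ (p/2)) * rk α (x - y) * g x
      + min (g x) (f y ^ (2/p)) * rk α (x - y) * f y := by
    intro x y
    rcases le_total (f y) (g x ^ (p/2)) with h | h
    · rw [min_eq_left h]
      refine le_trans (le_of_eq ?_) le_self_add
      ring
    · have : g x ≤ f y ^ (2/p) := by
        have := ENNReal.rpow_le_rpow h (show 0 ≤ 2/p by positivity)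
        rw [← ENNReal.rpow_mul] at this
        rwa [show p / 2 * (2 / p) = 1 by field_simp, ENNReal.rpow_one] at this
      rw [min_eq_left this]
      refine le_trans (le_of_eq ?_) le_add_self
      ring
  calc ∫⁻ x, ∫⁻ y, rk α (x - y) * f y * g x
      ≤ ∫⁻ x, ∫⁻ y, (min (f y) (g x ^ (p/2)) * rk α (x - y) * g x
      + min (g x) (f y ^ (2/p)) * rk α (x - y) * f y) := by gcongr with x y; exact pw x y
    _ = (∫⁻ x, ∫⁻ y, min (f y) (g x ^ (p/2)) * rk α (x - y) * g x)
      + ∫⁻ x, ∫⁻ y, min (g x) (f y ^ (2/p)) * rk α (x - y) * f y := by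
        rw [← lintegral_add_left]
        · refine lintegral_congr fun x => ?_
          rw [lintegral_add_left]
          exact ((hf.min measurable_const).mul ((measurable_rk α).comp (by fun_prop))).mul_const _
        · refine Measurable.lintegral_prod_right'
            (f := fun z : ℝ × ℝ => min (f z.2) (g z.1 ^ (p/2)) * rk α (z.1 - z.2) * g z.1) ?_
          fun_prop
    _ = (∫⁻ x, ∫⁻ y, min (f y) (g x ^ (p/2)) * rk α (x - y) * g x)
      + ∫⁻ y, ∫⁻ x, min (g x) (f y ^ (2/p)) * rk α (x - y) * f y := by
        congr 1
        rw [lintegral_lintegral_swap]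
        refine Measurable.aemeasurable ?_
        simp only [Function.uncurry_def]
        fun_prop
    _ ≤ (∫⁻ x, C1 * g x ^ p) + ∫⁻ y, C2 * f y ^ (2:ℝ) := by
        gcongr with x y
        · rw [lintegral_mul_const _ (by fun_prop)]
          calc _ ≤ C1 * (g x ^ (p/2)) ^ (2/q) * g x := by gcongr; exact h1 f hf hf1 _ x
            _ = _ := by
              rw [← ENNReal.rpow_mul, mul_assoc]
              congr 1
              nth_rewrite 2 [← ENNReal.rpow_one (g x)]
              rw [← ENNReal.rpow_add_of_nonneg _ _ (by positivity) (by norm_num)]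
              congr 1
              rw [hp]; field_simp; ring
        · rw [lintegral_mul_const _ (by fun_prop)]
          calc _ ≤ C2 * (f y ^ (2/p)) ^ (p/2) * f y := by
                gcongr
                simp_rw [rk_symm α _ y]
                exact h2 g hg hg1 _ y
            _ = _ := by
              rw [← ENNReal.rpow_mul, mul_assoc, show 2 / p * (p / 2) = 1 by field_simp]
              congr 1
              rw [ENNReal.rpow_one, ENNReal.rpow_two, sq]
    _ ≤ C1 * 1 + C2 * 1 := by
        rw [lintegral_const_mul _ (by fun_prop), lintegral_const_mul _ (by fun_prop)]
        gcongr
    _ = C1 + C2 := by simp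

/-- L² → L^q bound for convolution with kernel k -/
def Cbd (k : ℝ → ℝ≥0∞) (q : ℝ) (M : ℝ≥0∞) : Prop :=
  ∀ f : ℝ → ℝ≥0∞, Measurable f →
    (∫⁻ x, (∫⁻ y, k (x - y) * f y) ^ q) ^ (1 / q) ≤ M * (∫⁻ y, f y ^ 2) ^ ((1:ℝ)/2)

theorem hls_norm {q : ℝ} (hq : 2 < q) :
    ∃ C : ℝ≥0∞, C ≠ ⊤ ∧ C ≠ 0 ∧ ∀ f : ℝ → ℝ≥0∞, Measurable f →
      ∫⁻ z, f z ^ (2:ℝ) ≤ 1 →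
      (∫⁻ x, (∫⁻ y, rk (1/2 + 1/q) (x - y) * f y) ^ q) ≤ C ^ q := by
  obtain ⟨C, hC, hC0, h⟩ := hls_bilin hq
  refine ⟨C, hC, hC0, fun f hf hf1 => ?_⟩
  set α := 1/2 + 1/q with hα
  have hrk := measurable_rk α
  set p := q / (q - 1) with hp
  have hq1 : q - 1 ≠ 0 := by linarith
  have hq0 : 0 < q := by linarith
  have hp1 : 1 < p := by rw [hp, lt_div_iff₀ (by linarith)]; linarith
  have hp0 : 0 < p := by linarith
  set w : ℝ → ℝ≥0∞ := fun x => ∫⁻ y, rk α (x - y) * f y with hw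
  have hwm : Measurable w := by
    refine Measurable.lintegral_prod_right' (f := fun z : ℝ × ℝ => rk α (z.1 - z.2) * f z.2) ?_
    fun_prop
  have step : ∀ n : ℕ, ∫⁻ x, ((Icc (-(n:ℝ)) n).indicator (fun x => min (w x) n) x) ^ q ≤ C ^ q := by
    intro n
    set G : ℝ → ℝ≥0∞ := (Icc (-(n:ℝ)) n).indicator (fun x => min (w x) n) with hG
    have hGm : Measurable G := (hwm.min measurable_const).indicator measurableSet_Icc
    have hGw : ∀ x, G x ≤ w x := fun x => by
      rw [hG, indicator]; split_ifs
      · exact min_le_left _ _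
      · exact zero_le
    set I := ∫⁻ x, G x ^ q with hI
    have hIt : I ≠ ⊤ := by
      have : I ≤ ∫⁻ x, (Icc (-(n:ℝ)) n).indicator (fun x => (n:ℝ≥0∞) ^ q) x := by
        rw [hI]; gcongr with x
        rw [hG, indicator, indicator]; split_ifs
        · gcongr; exact min_le_right _ _
        · simp [hq0]
      rw [lintegral_indicator measurableSet_Icc, setLIntegral_const] at this
      refine ne_top_of_le_ne_top ?_ this
      refine ENNReal.mul_ne_top (ENNReal.rpow_ne_top_of_nonneg hq0.le (by simp)) (by simp)
    rcases eq_or_ne I 0 with h0 | h0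
    · rw [h0]; exact zero_le
    have hIp0 : I ^ (1/p) ≠ 0 := by simp [h0, hIt]
    have hIpt : I ^ (1/p) ≠ ⊤ := ENNReal.rpow_ne_top_of_nonneg (by positivity) hIt
    have hb := h f (fun x => G x ^ (q - 1) * (I ^ (1/p))⁻¹) hf (by fun_prop) hf1 (by
      simp_rw [ENNReal.mul_rpow_of_nonneg _ _ hp0.le]
      rw [lintegral_mul_const _ (by fun_prop), ← ENNReal.inv_rpow, ← ENNReal.rpow_mul,
        one_div_mul_cancel hp0.ne', ENNReal.rpow_one]
      simp_rw [← ENNReal.rpow_mul]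
      rw [show (q - 1) * p = q by rw [hp]; field_simp, ENNReal.mul_inv_cancel h0 hIt])
    have hb2 : I * (I ^ (1/p))⁻¹ ≤ C := by
      refine le_trans ?_ hb
      calc I * (I ^ (1/p))⁻¹ = ∫⁻ x, G x ^ q * (I ^ (1/p))⁻¹ := by
            rw [lintegral_mul_const _ (by fun_prop)]
        _ ≤ ∫⁻ x, w x * (G x ^ (q - 1) * (I ^ (1/p))⁻¹) := by
            refine lintegral_mono fun x => ?_
            rw [← mul_assoc]
            refine mul_le_mul_left ?_ _
            calc G x ^ q = G x ^ (1 + (q - 1)) := by congr 1; ring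
              _ = G x * G x ^ (q - 1) := by
                rw [ENNReal.rpow_add_of_nonneg _ _ (by norm_num) (by linarith), ENNReal.rpow_one]
              _ ≤ _ := by gcongr; exact hGw x
        _ = _ := by
            refine lintegral_congr fun x => ?_
            rw [lintegral_mul_const _ (by fun_prop)]
    have hb3 : I ^ (1/q) ≤ C := by
      refine le_trans (le_of_eq ?_) hb2
      rw [← ENNReal.rpow_neg]
      nth_rewrite 2 [← ENNReal.rpow_one I]
      rw [← ENNReal.rpow_add _ _ h0 hIt]
      congr 1; rw [hp]; field_simp; ring
    calc I = (I ^ (1/q)) ^ q := by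
          rw [← ENNReal.rpow_mul, one_div_mul_cancel hq0.ne', ENNReal.rpow_one]
      _ ≤ _ := by gcongr
  have lim : ∀ x, Tendsto (fun n : ℕ => ((Icc (-(n:ℝ)) n).indicator (fun x => min (w x) n) x) ^ q)
      atTop (nhds (w x ^ q)) := by
    intro x
    refine (ENNReal.continuous_rpow_const.tendsto _).comp ?_
    have t1 : Tendsto (fun n : ℕ => min (w x) (n:ℝ≥0∞)) atTop (nhds (min (w x) ⊤)) :=
      tendsto_const_nhds.min ENNReal.tendsto_nat_nhds_top
    rw [min_eq_left le_top] at t1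
    refine t1.congr' ?_
    filter_upwards [eventually_ge_atTop (Nat.ceil |x|)] with n hn
    have : |x| ≤ n := (Nat.le_ceil _).trans (by exact_mod_cast hn)
    rw [indicator_of_mem]
    exact abs_le.1 this
  calc ∫⁻ x, w x ^ q = ∫⁻ x, liminf (fun n : ℕ =>
        ((Icc (-(n:ℝ)) n).indicator (fun x => min (w x) n) x) ^ q) atTop := by
        refine lintegral_congr fun x => ?_
        rw [(lim x).liminf_eq]
    _ ≤ liminf (fun n : ℕ => ∫⁻ x,
        ((Icc (-(n:ℝ)) n).indicator (fun x => min (w x) n) x) ^ q) atTop := by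
        refine lintegral_liminf_le fun n => ?_
        exact ((hwm.min measurable_const).indicator measurableSet_Icc).pow_const _
    _ ≤ C ^ q := by
        refine (liminf_le_liminf (Eventually.of_forall step)).trans ?_
        simp

theorem hls {q : ℝ} (hq : 2 < q) :
    ∃ C : ℝ≥0∞, C ≠ ⊤ ∧ Cbd (rk (1/2 + 1/q)) q C := by
  obtain ⟨C, hC, hC0, h⟩ := hls_norm hq
  refine ⟨C, hC, fun f hf => ?_⟩
  have hq0 : 0 < q := by linarith
  set α := 1/2 + 1/q with hα
  have hrk := measurable_rk α
  set J := ∫⁻ y, f y ^ 2 with hJ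
  rcases eq_or_ne J ⊤ with ht | ht
  · rw [ht, ENNReal.top_rpow_of_pos (by norm_num), ENNReal.mul_top hC0]; exact le_top
  rcases eq_or_ne J 0 with h0 | h0
  · have : f =ᵐ[volume] 0 := by
      rw [hJ, lintegral_eq_zero_iff (by fun_prop)] at h0
      filter_upwards [h0] with x hx
      simpa using hx
    have e : ∀ x, ∫⁻ y, rk α (x - y) * f y = 0 := by
      intro x
      rw [lintegral_eq_zero_iff (by fun_prop)]
      filter_upwards [this] with y hy
      simp [hy]
    simp [e, hq0]
  set s := J ^ ((1:ℝ)/2) with hs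
  have hs0 : s ≠ 0 := by simp [hs, h0, ht]
  have hst : s ≠ ⊤ := ENNReal.rpow_ne_top_of_nonneg (by positivity) ht
  have hss : s ^ (2:ℝ) = J := by rw [hs, ← ENNReal.rpow_mul]; simp
  have := h (fun y => f y * s⁻¹) (by fun_prop) (by
    simp_rw [ENNReal.mul_rpow_of_nonneg _ _ (by norm_num : (0:ℝ) ≤ 2)]
    rw [lintegral_mul_const _ (by fun_prop), ENNReal.inv_rpow, hss]
    simp_rw [ENNReal.rpow_two]
    rw [ENNReal.mul_inv_cancel h0 ht])
  have e : ∀ x, ∫⁻ y, rk α (x - y) * (f y * s⁻¹) = (∫⁻ y, rk α (x - y) * f y) * s⁻¹ := by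
    intro x
    rw [← lintegral_mul_const _ (by fun_prop)]
    refine lintegral_congr fun y => by ring
  simp_rw [e, ENNReal.mul_rpow_of_nonneg _ _ hq0.le] at this
  have hm : Measurable fun x => ∫⁻ y, rk α (x - y) * f y := by
    refine Measurable.lintegral_prod_right' (f := fun z : ℝ × ℝ => rk α (z.1 - z.2) * f z.2) ?_
    fun_prop
  rw [lintegral_mul_const _ (by fun_prop)] at this
  have t2 := ENNReal.rpow_le_rpow this (show 0 ≤ 1 / q by positivity)
  rw [ENNReal.mul_rpow_of_nonneg _ _ (by positivity), ← ENNReal.rpow_mul, ← ENNReal.rpow_mul,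
    mul_one_div_cancel hq0.ne', ENNReal.rpow_one, ENNReal.rpow_one] at t2
  rw [← div_eq_mul_inv, ENNReal.div_le_iff hs0 hst] at t2
  exact t2

theorem lq_pull {X : Type*} [MeasurableSpace X] (μ : Measure X) {q : ℝ} (hq : 0 < q) (c : ℝ≥0∞)
    {g : X → ℝ≥0∞} (hg : Measurable g) :
    (∫⁻ x, (c * g x) ^ q ∂μ) ^ (1 / q) = c * (∫⁻ x, g x ^ q ∂μ) ^ (1 / q) := by
  simp_rw [ENNReal.mul_rpow_of_nonneg _ _ hq.le]
  rw [lintegral_const_mul _ (by fun_prop), ENNReal.mul_rpow_of_nonneg _ _ (by positivity),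
    ← ENNReal.rpow_mul, mul_one_div_cancel hq.ne', ENNReal.rpow_one]

theorem sq_half (a : ℝ≥0∞) : (a ^ 2) ^ ((1:ℝ)/2) = a := by
  rw [← ENNReal.rpow_natCast, ← ENNReal.rpow_mul]; simp

theorem half_sq (a : ℝ≥0∞) : (a ^ ((1:ℝ)/2)) ^ 2 = a := by
  rw [← ENNReal.rpow_natCast, ← ENNReal.rpow_mul]; simp

theorem l2_pull {X : Type*} [MeasurableSpace X] (μ : Measure X) (c : ℝ≥0∞)
    {g : X → ℝ≥0∞} (hg : Measurable g) :
    (∫⁻ x, (c * g x) ^ 2 ∂μ) ^ ((1:ℝ)/2) = c * (∫⁻ x, g x ^ 2 ∂μ) ^ ((1:ℝ)/2) := by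
  simpa using lq_pull μ (q := 2) (by norm_num) c hg

theorem meas_conv {k f : ℝ → ℝ≥0∞} (hk : Measurable k) (hf : Measurable f) :
    Measurable fun x => ∫⁻ y, k (x - y) * f y := by
  refine Measurable.lintegral_prod_right' (f := fun z : ℝ × ℝ => k (z.1 - z.2) * f z.2) ?_
  fun_prop

theorem Cbd.mono {k k' : ℝ → ℝ≥0∞} {q : ℝ} (hq : 0 < q) {c M : ℝ≥0∞} (hk' : Measurable k')
    (h : Cbd k' q M) (hkk : ∀ z, k z ≤ c * k' z) : Cbd k q (c * M) := by
  intro f hf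
  calc _ ≤ (∫⁻ x, (c * ∫⁻ y, k' (x - y) * f y) ^ q) ^ (1 / q) := by
        gcongr with x
        rw [← lintegral_const_mul _ (by fun_prop)]
        refine lintegral_mono fun y => ?_
        rw [← mul_assoc]
        gcongr
        exact hkk _
    _ = c * (∫⁻ x, (∫⁻ y, k' (x - y) * f y) ^ q) ^ (1 / q) := lq_pull _ hq _ (meas_conv hk' hf)
    _ ≤ c * (M * (∫⁻ y, f y ^ 2) ^ ((1:ℝ)/2)) := by gcongr; exact h f hf
    _ = _ := by ring

theorem Cbd_L1 {k : ℝ → ℝ≥0∞} (hk : Measurable k) : Cbd k 2 (∫⁻ z, k z) := by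
  intro f hf
  have e : ∀ x, ∫⁻ y, k (x - y) * f y = ∫⁻ z, k z * f (x - z) := by
    intro x
    rw [← lintegral_sub_left_eq_self (fun z => k z * f (x - z)) x]
    simp
  simp_rw [e]
  have := lint_mink (volume : Measure ℝ) (volume : Measure ℝ) (F := fun z x => k z * f (x - z))
    (by simp only [Function.uncurry_def]; fun_prop)
  simp only [ENNReal.rpow_two]
  refine this.trans (le_of_eq ?_)
  rw [← lintegral_mul_const _ hk]
  refine lintegral_congr fun z => ?_
  rw [l2_pull _ _ (by fun_prop), lintegral_sub_right_eq_self (fun x => f x ^ 2)]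

/-- truncated kernel -/
def kr (b r : ℝ) : ℝ → ℝ≥0∞ := {z : ℝ | |z| < r}.indicator (rk b)

theorem measurable_kr (b r : ℝ) : Measurable (kr b r) :=
  (measurable_rk b).indicator (measurableSet_lt (by fun_prop) (by fun_prop))

theorem kr_bd {q b : ℝ} (hq : 2 ≤ q) (hb : b ≤ 1/2 + 1/q) (hb2 : q = 2 → b < 1/2 + 1/q) :
    ∃ C : ℝ≥0∞, C ≠ ⊤ ∧ ∀ r : ℝ, 0 < r →
      Cbd (kr b r) q (ENNReal.ofReal r ^ (1/2 + 1/q - b) * C) := by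
  rcases eq_or_lt_of_le hq with h | h
  · subst h
    have hb1 : b < 1 := by have := hb2 rfl; linarith
    refine ⟨ENNReal.ofReal (2 / (1 - b)), ENNReal.ofReal_ne_top, fun r hr => ?_⟩
    have := Cbd_L1 (measurable_kr b r)
    rw [kr, lintegral_indicator (measurableSet_lt (by fun_prop) (by fun_prop)),
      lint_near hb1 hr, mul_comm] at this
    norm_num
    exact this
  · obtain ⟨C, hC, hh⟩ := hls h
    refine ⟨C, hC, fun r hr => ?_⟩
    refine Cbd.mono (by linarith) (measurable_rk _) hh fun z => ?_
    rw [kr, indicator]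
    split_ifs with hz
    · have hz : |z| < r := hz
      rcases eq_or_ne z 0 with rfl | h0
      · rw [rk, rk, abs_zero, ENNReal.ofReal_zero, ENNReal.zero_rpow_of_neg (y := -(1/2 + 1/q)),
          ENNReal.mul_top]
        · exact le_top
        · simp [hr]
        · have : 0 < q := by linarith
          have : 0 < 1/q := by positivity
          linarith
      · have h1 : ENNReal.ofReal |z| ≠ 0 := by simpa using h0
        rw [rk, rk, show -b = (1/2 + 1/q - b) + -(1/2 + 1/q) by ring,
          ENNReal.rpow_add _ _ h1 ENNReal.ofReal_ne_top]
        gcongr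
    · exact zero_le

theorem mink_k {Y : Type*} [MeasurableSpace Y] (ν : Measure Y) [SFinite ν] {k : ℝ → ℝ≥0∞}
    (hk : Measurable k) {Φ : ℝ → Y → ℝ≥0∞} (hΦ : Measurable fun p : ℝ × Y => Φ p.1 p.2) (x : ℝ) :
    (∫⁻ y, (∫⁻ s, k (x - s) * Φ s y) ^ 2 ∂ν) ^ ((1:ℝ)/2)
      ≤ ∫⁻ s, k (x - s) * (∫⁻ y, Φ s y ^ 2 ∂ν) ^ ((1:ℝ)/2) := by
  have := lint_mink (volume : Measure ℝ) ν (F := fun s y => k (x - s) * Φ s y)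
    (by
      simp only [Function.uncurry_def]
      exact (hk.comp (by fun_prop : Measurable fun p : ℝ × Y => x - p.1)).mul hΦ)
  refine this.trans (le_of_eq ?_)
  refine lintegral_congr fun s => ?_
  have hs : Measurable fun y => Φ s y := hΦ.comp (by fun_prop : Measurable fun y => (s, y))
  rw [l2_pull _ _ hs]

theorem mixed {k1 k2 k3 : ℝ → ℝ≥0∞} (hk1 : Measurable k1) (hk2 : Measurable k2)
    (hk3 : Measurable k3) {q1 q2 q3 : ℝ} (hq2 : 0 < q2) (hq3 : 0 < q3)
    {M1 M2 M3 : ℝ≥0∞} (h1 : Cbd k1 q1 M1) (h2 : Cbd k2 q2 M2) (h3 : Cbd k3 q3 M3)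
    {F : ℝ × ℝ × ℝ → ℝ≥0∞} (hF : Measurable F) :
    (∫⁻ x3, (∫⁻ x2, (∫⁻ x1, (∫⁻ y3, ∫⁻ y2, ∫⁻ y1,
      k1 (x1 - y1) * k2 (x2 - y2) * k3 (x3 - y3) * F (y1, y2, y3)) ^ q1) ^ (q2 / q1)) ^ (q3 / q2))
        ^ (1 / q3)
      ≤ M1 * M2 * M3 * (∫⁻ y3, ∫⁻ y2, ∫⁻ y1, F (y1, y2, y3) ^ 2) ^ ((1:ℝ)/2) := by
  set v : ℝ → ℝ → ℝ → ℝ≥0∞ := fun x3 y1 y2 => ∫⁻ y3, k3 (x3 - y3) * F (y1, y2, y3) with hv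
  have mv : Measurable fun p : ℝ × ℝ × ℝ => v p.1 p.2.1 p.2.2 := by
    refine Measurable.lintegral_prod_right'
      (f := fun z : (ℝ × ℝ × ℝ) × ℝ => k3 (z.1.1 - z.2) * F (z.1.2.1, z.1.2.2, z.2)) ?_
    fun_prop
  set u : ℝ → ℝ → ℝ → ℝ≥0∞ := fun x2 x3 y1 => ∫⁻ y2, k2 (x2 - y2) * v x3 y1 y2 with hu
  have mu : ∀ x2 x3, Measurable fun y1 => u x2 x3 y1 := by
    intro x2 x3
    refine Measurable.lintegral_prod_right'
      (f := fun z : ℝ × ℝ => k2 (x2 - z.2) * v x3 z.1 z.2) ?_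
    exact (hk2.comp (by fun_prop : Measurable fun z : ℝ × ℝ => x2 - z.2)).mul
      (mv.comp (by fun_prop : Measurable fun z : ℝ × ℝ => (x3, z.1, z.2)))
  have inner : ∀ x1 x2 x3, (∫⁻ y3, ∫⁻ y2, ∫⁻ y1,
      k1 (x1 - y1) * k2 (x2 - y2) * k3 (x3 - y3) * F (y1, y2, y3))
      = ∫⁻ y1, k1 (x1 - y1) * u x2 x3 y1 := by
    intro x1 x2 x3
    calc _ = ∫⁻ y3, ∫⁻ y1, ∫⁻ y2, k1 (x1 - y1) * k2 (x2 - y2) * k3 (x3 - y3) * F (y1, y2, y3) := by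
          refine lintegral_congr fun y3 => ?_
          rw [lintegral_lintegral_swap]
          simp only [Function.uncurry_def]; fun_prop
      _ = ∫⁻ y1, ∫⁻ y3, ∫⁻ y2, k1 (x1 - y1) * k2 (x2 - y2) * k3 (x3 - y3) * F (y1, y2, y3) := by
          rw [lintegral_lintegral_swap]
          refine Measurable.aemeasurable ?_
          refine Measurable.lintegral_prod_right' (f := fun z : (ℝ × ℝ) × ℝ =>
            k1 (x1 - z.1.2) * k2 (x2 - z.2) * k3 (x3 - z.1.1) * F (z.1.2, z.2, z.1.1)) ?_
          fun_prop
      _ = ∫⁻ y1, ∫⁻ y2, ∫⁻ y3, k1 (x1 - y1) * k2 (x2 - y2) * k3 (x3 - y3) * F (y1, y2, y3) := by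
          refine lintegral_congr fun y1 => ?_
          rw [lintegral_lintegral_swap]
          simp only [Function.uncurry_def]; fun_prop
      _ = _ := by
          refine lintegral_congr fun y1 => ?_
          rw [hu]
          dsimp only
          rw [← lintegral_const_mul]
          · refine lintegral_congr fun y2 => ?_
            rw [hv]
            dsimp only
            rw [← mul_assoc, ← lintegral_const_mul _ (by fun_prop)]
            refine lintegral_congr fun y3 => ?_
            ring
          · exact (hk2.comp (by fun_prop : Measurable fun z : ℝ => x2 - z)).mul
              (mv.comp (by fun_prop : Measurable fun z : ℝ => (x3, y1, z)))
  simp_rw [inner]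
  set n2 : ℝ → ℝ → ℝ≥0∞ := fun x3 y2 => (∫⁻ y1, v x3 y1 y2 ^ 2) ^ ((1:ℝ)/2) with hn2
  have mn2 : ∀ x3, Measurable fun y2 => n2 x3 y2 := by
    intro x3
    refine Measurable.pow_const ?_ _
    refine Measurable.lintegral_prod_right' (f := fun z : ℝ × ℝ => v x3 z.2 z.1 ^ 2) ?_
    exact (mv.comp (by fun_prop : Measurable fun z : ℝ × ℝ => (x3, z.2, z.1))).pow_const 2
  have s1 : ∀ x2 x3, (∫⁻ x1, (∫⁻ y1, k1 (x1 - y1) * u x2 x3 y1) ^ q1) ^ (1 / q1)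
      ≤ M1 * ∫⁻ y2, k2 (x2 - y2) * n2 x3 y2 := by
    intro x2 x3
    refine (h1 _ (mu x2 x3)).trans ?_
    gcongr
    exact mink_k volume hk2 (Φ := fun y2 y1 => v x3 y1 y2)
      (mv.comp (by fun_prop : Measurable fun z : ℝ × ℝ => (x3, z.2, z.1))) x2
  set N : ℝ → ℝ → ℝ≥0∞ := fun y3 y2 => (∫⁻ y1, F (y1, y2, y3) ^ 2) ^ ((1:ℝ)/2) with hN
  have mN : Measurable fun p : ℝ × ℝ => N p.1 p.2 := by
    refine Measurable.pow_const ?_ _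
    refine Measurable.lintegral_prod_right'
      (f := fun z : (ℝ × ℝ) × ℝ => F (z.2, z.1.2, z.1.1) ^ 2) ?_
    fun_prop
  set n3 : ℝ → ℝ≥0∞ := fun y3 => (∫⁻ y2, N y3 y2 ^ 2) ^ ((1:ℝ)/2) with hn3
  have mn3 : Measurable n3 := by
    refine Measurable.pow_const ?_ _
    exact Measurable.lintegral_prod_right' (f := fun z : ℝ × ℝ => N z.1 z.2 ^ 2) (mN.pow_const 2)
  have s2 : ∀ x3, (∫⁻ x2, (∫⁻ x1, (∫⁻ y1, k1 (x1 - y1) * u x2 x3 y1) ^ q1) ^ (q2 / q1)) ^ (1 / q2)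
      ≤ M1 * M2 * ∫⁻ y3, k3 (x3 - y3) * n3 y3 := by
    intro x3
    calc _ ≤ (∫⁻ x2, (M1 * ∫⁻ y2, k2 (x2 - y2) * n2 x3 y2) ^ q2) ^ (1 / q2) := by
          gcongr with x2
          rw [show q2 / q1 = 1 / q1 * q2 by ring, ENNReal.rpow_mul]
          gcongr
          exact s1 x2 x3
      _ = M1 * (∫⁻ x2, (∫⁻ y2, k2 (x2 - y2) * n2 x3 y2) ^ q2) ^ (1 / q2) :=
          lq_pull _ hq2 _ (meas_conv hk2 (mn2 x3))
      _ ≤ M1 * (M2 * (∫⁻ y2, n2 x3 y2 ^ 2) ^ ((1:ℝ)/2)) := by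
          gcongr; exact h2 _ (mn2 x3)
      _ ≤ M1 * (M2 * (∫⁻ y2, (∫⁻ y3, k3 (x3 - y3) * N y3 y2) ^ 2) ^ ((1:ℝ)/2)) := by
          gcongr with y2
          exact mink_k volume hk3 (Φ := fun y3 y1 => F (y1, y2, y3)) (by fun_prop) x3
      _ ≤ M1 * (M2 * ∫⁻ y3, k3 (x3 - y3) * n3 y3) := by
          gcongr
          exact mink_k volume hk3 mN x3
      _ = _ := by ring
  calc _ ≤ (∫⁻ x3, (M1 * M2 * ∫⁻ y3, k3 (x3 - y3) * n3 y3) ^ q3) ^ (1 / q3) := by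
        gcongr with x3
        rw [show q3 / q2 = 1 / q2 * q3 by ring, ENNReal.rpow_mul]
        gcongr
        exact s2 x3
    _ = M1 * M2 * (∫⁻ x3, (∫⁻ y3, k3 (x3 - y3) * n3 y3) ^ q3) ^ (1 / q3) :=
        lq_pull _ hq3 _ (meas_conv hk3 mn3)
    _ ≤ M1 * M2 * (M3 * (∫⁻ y3, n3 y3 ^ 2) ^ ((1:ℝ)/2)) := by
        gcongr; exact h3 _ mn3
    _ = _ := by
        simp_rw [hn3, half_sq, hN, half_sq]
        ring

theorem measurable_pt3 : Measurable fun p : ℝ × ℝ × ℝ => pt3 p.1 p.2.1 p.2.2 := by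
  unfold pt3
  refine (MeasurableEquiv.toLp 2 (Fin 3 → ℝ)).measurable.comp ?_
  refine measurable_pi_lambda _ fun i => ?_
  fin_cases i <;> simp <;> fun_prop

theorem lint_E3 {G : E3 → ℝ≥0∞} (hG : Measurable G) :
    ∫⁻ x, G x = ∫⁻ x3, ∫⁻ x2, ∫⁻ x1, G (pt3 x1 x2 x3) := by
  have hG3 := hG.comp measurable_pt3
  have e1 : ∫⁻ x, G x = ∫⁻ w : Fin 3 → ℝ, G (WithLp.toLp 2 w) :=
    ((EuclideanSpace.volume_preserving_symm_measurableEquiv_toLp (Fin 3)).symm.lintegral_comp hG).symm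
  have e2 : ∫⁻ w : Fin 3 → ℝ, G (WithLp.toLp 2 w)
      = ∫⁻ p : ℝ × (Fin 2 → ℝ), G (pt3 p.1 (p.2 0) (p.2 1)) := by
    rw [← (volume_preserving_piFinSuccAbove (fun _ : Fin 3 => ℝ) 0).lintegral_comp]
    · refine lintegral_congr fun w => ?_
      congr 1
      ext i
      fin_cases i <;> rfl
    · exact hG3.comp (by fun_prop : Measurable fun p : ℝ × (Fin 2 → ℝ) => (p.1, p.2 0, p.2 1))
  have e3 : ∀ x1 : ℝ, ∫⁻ w : Fin 2 → ℝ, G (pt3 x1 (w 0) (w 1))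
      = ∫⁻ p : ℝ × ℝ, G (pt3 x1 p.1 p.2) := by
    intro x1
    rw [← (volume_preserving_finTwoArrow ℝ).lintegral_comp]
    · rfl
    · exact hG3.comp (by fun_prop : Measurable fun p : ℝ × ℝ => (x1, p.1, p.2))
  rw [e1, e2, Measure.volume_eq_prod, lintegral_prod]
  swap
  · exact (hG3.comp (by fun_prop : Measurable fun p : ℝ × (Fin 2 → ℝ) => (p.1, p.2 0, p.2 1))).aemeasurable
  simp_rw [e3]
  rw [lintegral_lintegral_swap, Measure.volume_eq_prod, lintegral_prod_symm]
  · refine Measurable.aemeasurable ?_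
    refine Measurable.lintegral_prod_right' (f := fun z : (ℝ × ℝ) × ℝ => G (pt3 z.2 z.1.1 z.1.2)) ?_
    exact hG3.comp (by fun_prop : Measurable fun z : (ℝ × ℝ) × ℝ => (z.2, z.1.1, z.1.2))
  · refine Measurable.aemeasurable ?_
    exact hG3.comp (by fun_prop : Measurable fun z : ℝ × ℝ × ℝ => (z.1, z.2.1, z.2.2))

/-- iterated norm for nonnegative functions -/
def AN (q1 q2 q3 : ℝ) (G : E3 → ℝ≥0∞) : ℝ≥0∞ :=
  (∫⁻ x3 : ℝ, (∫⁻ x2 : ℝ, (∫⁻ x1 : ℝ,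
      (G (pt3 x1 x2 x3)) ^ q1) ^ (q2 / q1)) ^ (q3 / q2)) ^ (1 / q3)

/-- truncated kernel on 3-space -/
def K3 (r : ℝ) (x y : E3) : ℝ≥0∞ :=
  (ball x r).indicator (fun y => (ENNReal.ofReal (dist y x)) ^ (-(2:ℝ))) y

theorem coord_le (x1 x2 x3 y1 y2 y3 : ℝ) :
    |x1 - y1| ≤ dist (pt3 y1 y2 y3) (pt3 x1 x2 x3) ∧ |x2 - y2| ≤ dist (pt3 y1 y2 y3) (pt3 x1 x2 x3) ∧
    |x3 - y3| ≤ dist (pt3 y1 y2 y3) (pt3 x1 x2 x3) := by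
  have h : ∀ i, |(pt3 x1 x2 x3) i - (pt3 y1 y2 y3) i| ≤ dist (pt3 y1 y2 y3) (pt3 x1 x2 x3) := by
    intro i
    rw [dist_comm, dist_eq_norm]
    have := PiLp.norm_apply_le (pt3 x1 x2 x3 - pt3 y1 y2 y3) i
    simpa using this
  exact ⟨h 0, h 1, h 2⟩

theorem K3_le {b1 b2 b3 : ℝ} (h1 : 0 < b1) (h2 : 0 < b2) (h3 : 0 < b3) (hs : b1 + b2 + b3 = 2)
    (r x1 x2 x3 y1 y2 y3 : ℝ) :
    K3 r (pt3 x1 x2 x3) (pt3 y1 y2 y3)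
      ≤ kr b1 r (x1 - y1) * kr b2 r (x2 - y2) * kr b3 r (x3 - y3) := by
  obtain ⟨c1, c2, c3⟩ := coord_le x1 x2 x3 y1 y2 y3
  set d := dist (pt3 y1 y2 y3) (pt3 x1 x2 x3) with hd
  by_cases hr : pt3 y1 y2 y3 ∈ ball (pt3 x1 x2 x3) r
  swap
  · rw [K3, indicator_of_notMem hr]; exact zero_le
  have hr' : d < r := hr
  rw [K3, indicator_of_mem hr, ← hd]
  rw [kr, kr, kr, indicator_of_mem (show x1 - y1 ∈ {z : ℝ | |z| < r} from c1.trans_lt hr'),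
    indicator_of_mem (show x2 - y2 ∈ {z : ℝ | |z| < r} from c2.trans_lt hr'),
    indicator_of_mem (show x3 - y3 ∈ {z : ℝ | |z| < r} from c3.trans_lt hr')]
  have mono : ∀ {b s : ℝ}, 0 < b → |s| ≤ d → ENNReal.ofReal d ^ (-b) ≤ rk b s := by
    intro b s hb hs
    rw [rk, ENNReal.rpow_neg, ENNReal.rpow_neg]
    gcongr
  calc ENNReal.ofReal d ^ (-(2:ℝ))
      ≤ ENNReal.ofReal d ^ (-b1) * ENNReal.ofReal d ^ (-b2) * ENNReal.ofReal d ^ (-b3) := by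
        rcases eq_or_ne (ENNReal.ofReal d) 0 with h0 | h0
        · rw [h0, ENNReal.zero_rpow_of_neg (y := -b1) (by linarith),
            ENNReal.zero_rpow_of_neg (y := -b2) (by linarith),
            ENNReal.zero_rpow_of_neg (y := -b3) (by linarith)]
          simp
        · rw [← ENNReal.rpow_add _ _ h0 ENNReal.ofReal_ne_top,
            ← ENNReal.rpow_add _ _ h0 ENNReal.ofReal_ne_top]
          apply le_of_eq; congr 1; linarith
    _ ≤ _ := by
        gcongr
        · exact mono h1 c1
        · exact mono h2 c2
        · exact mono h3 c3

theorem measurable_K3 (r : ℝ) (x : E3) : Measurable (K3 r x) := by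
  unfold K3
  exact Measurable.indicator (by fun_prop) measurableSet_ball

theorem conv_bd {q1 q2 q3 θ : ℝ} (hq1 : 2 ≤ q1) (hq2 : 2 ≤ q2) (hq3 : 2 ≤ q3)
    (hθ : θ + (1/q1 + 1/q2 + 1/q3) = 3/2) (hθ1 : θ ≤ 1) :
    ∃ C : ℝ≥0∞, C ≠ ⊤ ∧ ∀ r : ℝ, 0 < r → ∀ H : E3 → ℝ≥0∞, Measurable H → ∀ G : E3 → ℝ≥0∞,
      (∀ x, G x ≤ ∫⁻ y, K3 r x y * H y) →
      AN q1 q2 q3 G ≤ C * ENNReal.ofReal r ^ (1 - θ) * (∫⁻ y, H y ^ 2) ^ ((1:ℝ)/2) := by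
  have i1 : 0 < 1 / q1 := by positivity
  have i2 : 0 < 1 / q2 := by positivity
  have i3 : 0 < 1 / q3 := by positivity
  have j1 : 1 / q1 ≤ 1 / 2 := one_div_le_one_div_of_le (by norm_num) hq1
  have j2 : 1 / q2 ≤ 1 / 2 := one_div_le_one_div_of_le (by norm_num) hq2
  have j3 : 1 / q3 ≤ 1 / 2 := one_div_le_one_div_of_le (by norm_num) hq3
  set b : ℝ → ℝ := fun q => 2 * (1/2 + 1/q) / (3 - θ) with hb
  have h3θ : 0 < 3 - θ := by linarith
  have hbpos : ∀ q, 0 < 1 / q → 0 < b q := fun q hq => by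
    rw [hb]; exact div_pos (by linarith) h3θ
  have hble : ∀ q, 0 < 1 / q → b q ≤ 1/2 + 1/q := fun q hq => by
    rw [hb]; dsimp only
    rw [div_le_iff₀ h3θ]
    nlinarith
  have hblt : ∀ q, 0 < 1 / q → (q = 2 → θ < 1) → q = 2 → b q < 1/2 + 1/q := fun q hq hh h2 => by
    have := hh h2
    rw [hb]; dsimp only
    rw [div_lt_iff₀ h3θ]
    nlinarith
  have hsum : b q1 + b q2 + b q3 = 2 := by
    rw [hb]; dsimp only
    rw [← add_div, ← add_div, div_eq_iff h3θ.ne']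
    linarith
  obtain ⟨C1, hC1, c1⟩ := kr_bd hq1 (hble q1 i1) (hblt q1 i1 (by rintro rfl; linarith))
  obtain ⟨C2, hC2, c2⟩ := kr_bd hq2 (hble q2 i2) (hblt q2 i2 (by rintro rfl; linarith))
  obtain ⟨C3, hC3, c3⟩ := kr_bd hq3 (hble q3 i3) (hblt q3 i3 (by rintro rfl; linarith))
  refine ⟨C1 * C2 * C3, ENNReal.mul_ne_top (ENNReal.mul_ne_top hC1 hC2) hC3, ?_⟩
  intro r hr H hH G hG
  have hF : Measurable fun p : ℝ × ℝ × ℝ => H (pt3 p.1 p.2.1 p.2.2) := hH.comp measurable_pt3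
  have := mixed (measurable_kr (b q1) r) (measurable_kr (b q2) r) (measurable_kr (b q3) r)
    (q1 := q1) (q2 := q2) (q3 := q3) (by linarith) (by linarith) (c1 r hr) (c2 r hr) (c3 r hr) hF
  rw [← lint_E3 (hH.pow_const 2)] at this
  rw [AN]
  calc _ ≤ _ := ?_
    _ ≤ _ := this
    _ = _ := ?_
  · have pw : ∀ x1 x2 x3, G (pt3 x1 x2 x3) ≤ ∫⁻ y3, ∫⁻ y2, ∫⁻ y1,
        kr (b q1) r (x1 - y1) * kr (b q2) r (x2 - y2) * kr (b q3) r (x3 - y3) * H (pt3 y1 y2 y3) := by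
      intro x1 x2 x3
      refine (hG _).trans ?_
      have hm : Measurable fun y => K3 r (pt3 x1 x2 x3) y * H y := (measurable_K3 r _).mul hH
      rw [lint_E3 hm]
      gcongr with y3 y2 y1
      exact K3_le (hbpos _ i1) (hbpos _ i2) (hbpos _ i3) hsum r x1 x2 x3 y1 y2 y3
    gcongr with x3 x2 x1
    exact pw x1 x2 x3
  · have hr0 : ENNReal.ofReal r ≠ 0 := by simpa using hr
    rw [show 1 - θ = (1/2 + 1/q1 - b q1) + (1/2 + 1/q2 - b q2) + (1/2 + 1/q3 - b q3) by linarith,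
      ENNReal.rpow_add _ _ hr0 ENNReal.ofReal_ne_top, ENNReal.rpow_add _ _ hr0 ENNReal.ofReal_ne_top]
    ring

theorem AN_two {G : E3 → ℝ≥0∞} (hG : Measurable G) :
    AN 2 2 2 G = (∫⁻ x, G x ^ 2) ^ ((1:ℝ)/2) := by
  rw [AN, lint_E3 (hG.pow_const 2)]
  simp

theorem lint_scale (G : E3 → ℝ≥0∞) (hG : Measurable G) {s : ℝ} (hs : 0 < s) :
    ∫⁻ w, G (s • w) = ENNReal.ofReal ((s^3)⁻¹) * ∫⁻ z, G z := by
  have h := Measure.map_addHaar_smul (volume : Measure E3) hs.ne'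
  have h2 : ∫⁻ w, G (s • w) = ∫⁻ z, G z ∂(Measure.map (s • ·) (volume : Measure E3)) := by
    rw [lintegral_map hG (measurable_const_smul s)]
  rw [h2, h, lintegral_smul_measure]
  have : Module.finrank ℝ E3 = 3 := by simp
  rw [this, abs_of_pos (by positivity), smul_eq_mul]

theorem lint_tail {R b : ℝ} (hR : 0 < R) (hb : 1 < b) :
    ∫⁻ s in Ioi R, (ENNReal.ofReal s) ^ (-b) = ENNReal.ofReal (R ^ (1 - b) / (b - 1)) := by
  have := integral_Ioi_rpow_of_lt (a := -b) (by linarith) hR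
  rw [show R ^ (1 - b) / (b - 1) = -R ^ (-b + 1) / (-b + 1) by
    rw [show -b + 1 = -(b - 1) by ring, neg_div_neg_eq]; ring_nf, ← this,
    ofReal_integral_eq_lintegral_ofReal (integrableOn_Ioi_rpow_of_lt (by linarith) hR)]
  · refine setLIntegral_congr_fun measurableSet_Ioi (fun s hs => ?_)
    exact ENNReal.ofReal_rpow_of_pos (hR.trans hs)
  · filter_upwards [ae_restrict_mem measurableSet_Ioi] with s hs
    exact Real.rpow_nonneg (hR.trans hs).le _

def psi (r : ℝ) (w : E3) : ℝ≥0∞ := (ball (0:E3) r).indicator (fun w => ENNReal.ofReal ‖w‖) w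

theorem measurable_psi (r : ℝ) : Measurable (psi r) :=
  Measurable.indicator (by fun_prop) measurableSet_ball

theorem psi_inner {r : ℝ} (hr : 0 < r) (z : E3) :
    ∫⁻ s in Ioo (0:ℝ) 1, ENNReal.ofReal ((s^3)⁻¹) * psi r (s⁻¹ • z)
      ≤ ENNReal.ofReal (r^3/3) *
        (ball (0:E3) r).indicator (fun z => (ENNReal.ofReal ‖z‖) ^ (-(2:ℝ))) z := by
  have hnorm : ∀ s : ℝ, 0 < s → ‖s⁻¹ • z‖ = ‖z‖ / s := by
    intro s hs
    rw [norm_smul, norm_inv, Real.norm_of_nonneg hs.le]; field_simp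
  by_cases hz : z ∈ ball (0:E3) r
  swap
  · rw [indicator_of_notMem hz, mul_zero]
    refine le_of_eq ?_
    rw [setLIntegral_congr_fun (g := fun _ => 0) measurableSet_Ioo, lintegral_zero]
    intro s hs
    have : s⁻¹ • z ∉ ball (0:E3) r := by
      simp only [mem_ball_zero_iff, not_lt] at hz ⊢
      rw [hnorm s hs.1, le_div_iff₀ hs.1]
      nlinarith [hs.1, hs.2]
    simp [psi, indicator_of_notMem this]
  rw [indicator_of_mem hz]
  rcases eq_or_ne z 0 with rfl | hz0
  · refine le_of_eq_of_le ?_ (zero_le)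
    have : psi r (0:E3) = 0 := by simp [psi, indicator]
    simp [this]
  have hzp : 0 < ‖z‖ := norm_pos_iff.2 hz0
  have hR : 0 < ‖z‖ / r := by positivity
  calc ∫⁻ s in Ioo (0:ℝ) 1, ENNReal.ofReal ((s^3)⁻¹) * psi r (s⁻¹ • z)
      ≤ ∫⁻ s in Ioi (0:ℝ), (Ioi (‖z‖/r)).indicator
          (fun s => ENNReal.ofReal ‖z‖ * (ENNReal.ofReal s) ^ (-(4:ℝ))) s := by
        refine (setLIntegral_mono' measurableSet_Ioo ?_).trans
          (lintegral_mono_set Ioo_subset_Ioi_self)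
        intro s hs
        by_cases hm : s⁻¹ • z ∈ ball (0:E3) r
        · have h1 : ‖z‖ / r < s := by
            rw [mem_ball_zero_iff, hnorm s hs.1, div_lt_iff₀ hs.1] at hm
            rw [div_lt_iff₀ hr]; linarith
          rw [psi, indicator_of_mem hm, indicator_of_mem (show s ∈ Ioi (‖z‖/r) from h1), hnorm s hs.1,
            ENNReal.ofReal_rpow_of_pos hs.1, ← ENNReal.ofReal_mul (by have := hs.1; positivity),
            ← ENNReal.ofReal_mul hzp.le]
          refine le_of_eq ?_
          congr 1
          rw [Real.rpow_neg hs.1.le, show (4:ℝ) = ((4:ℕ):ℝ) by norm_num, Real.rpow_natCast]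
          have := hs.1.ne'
          field_simp
        · simp [psi, indicator_of_notMem hm]
    _ = ENNReal.ofReal ‖z‖ * ∫⁻ s in Ioi (‖z‖/r), (ENNReal.ofReal s) ^ (-(4:ℝ)) := by
        rw [lintegral_indicator measurableSet_Ioi, Measure.restrict_restrict measurableSet_Ioi,
          inter_eq_left.2 (Ioi_subset_Ioi hR.le), lintegral_const_mul _ (by fun_prop)]
    _ = ENNReal.ofReal (r^3/3) * ENNReal.ofReal ‖z‖ ^ (-(2:ℝ)) := by
        rw [lint_tail hR (by norm_num), ENNReal.ofReal_rpow_of_pos hzp,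
          ← ENNReal.ofReal_mul hzp.le, ← ENNReal.ofReal_mul (by positivity)]
        congr 1
        rw [show (1:ℝ) - 4 = -((3:ℕ):ℝ) by norm_num, Real.rpow_neg hR.le, Real.rpow_natCast,
          Real.rpow_neg hzp.le, show (2:ℝ) = ((2:ℕ):ℝ) by norm_num, Real.rpow_natCast]
        field_simp
        norm_num
    _ ≤ _ := le_rfl

theorem ftc_line {g : E3 → ℝ} (hg : ContDiff ℝ 1 g) {D : Set E3} (hD : Convex ℝ D)
    {x y : E3} (hx : x ∈ D) (hy : y ∈ D) :
    ENNReal.ofReal |g x - g y| ≤ ∫⁻ s in Ioo (0:ℝ) 1,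
      ENNReal.ofReal ‖y - x‖ * D.indicator (fun z => ENNReal.ofReal ‖fderiv ℝ g z‖) (x + s • (y - x)) := by
  have hd : ∀ s : ℝ, HasDerivAt (fun s : ℝ => g (x + s • (y - x)))
      (fderiv ℝ g (x + s • (y - x)) (y - x)) s := by
    intro s
    have h1 : HasFDerivAt g (fderiv ℝ g (x + s • (y - x))) (x + s • (y - x)) :=
      (hg.differentiable (by norm_num) _).hasFDerivAt
    have h2 : HasDerivAt (fun s : ℝ => x + s • (y - x)) (y - x) s := by
      simpa using ((hasDerivAt_id s).smul_const (y - x)).const_add x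
    exact h1.comp_hasDerivAt s h2
  have hc : Continuous fun s : ℝ => fderiv ℝ g (x + s • (y - x)) (y - x) := by
    have := hg.continuous_fderiv (by norm_num)
    exact (this.comp (by fun_prop)).clm_apply continuous_const
  have h := intervalIntegral.integral_eq_sub_of_hasDerivAt (a := 0) (b := 1)
    (fun s _ => hd s) (hc.intervalIntegrable _ _)
  simp only [one_smul, zero_smul, add_zero, add_sub_cancel] at h
  rw [abs_sub_comm, ← h, intervalIntegral.integral_of_le zero_le_one]
  rw [← Real.norm_eq_abs, ofReal_norm_eq_enorm, integral_Ioc_eq_integral_Ioo]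
  refine (enorm_integral_le_lintegral_enorm _).trans ?_
  refine setLIntegral_mono' measurableSet_Ioo (fun s hs => ?_)
  have hm : x + s • (y - x) ∈ D := hD.add_smul_sub_mem hx hy ⟨hs.1.le, hs.2.le⟩
  rw [indicator_of_mem hm, ← ofReal_norm_eq_enorm, ← ENNReal.ofReal_mul (norm_nonneg _)]
  refine ENNReal.ofReal_le_ofReal ?_
  rw [mul_comm]
  exact ContinuousLinearMap.le_opNorm _ _

theorem osc {g : E3 → ℝ} (hg : ContDiff ℝ 1 g) {D : Set E3} (hD : Convex ℝ D)
    (hDm : MeasurableSet D) {x : E3} (hx : x ∈ D) {r : ℝ} (hr : 0 < r) (hDr : D ⊆ ball x r) :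
    ∫⁻ y in D, ENNReal.ofReal |g x - g y| ≤ ENNReal.ofReal (r^3/3) *
      ∫⁻ z, K3 r x z * D.indicator (fun z => ENNReal.ofReal ‖fderiv ℝ g z‖) z := by
  set Φ : E3 → ℝ≥0∞ := D.indicator (fun z => ENNReal.ofReal ‖fderiv ℝ g z‖) with hΦ
  have hΦm : Measurable Φ := by
    refine Measurable.indicator ?_ hDm
    have := (hg.continuous_fderiv (by norm_num)).measurable
    fun_prop
  have hψ := measurable_psi r
  calc ∫⁻ y in D, ENNReal.ofReal |g x - g y|
      ≤ ∫⁻ y in D, ∫⁻ s in Ioo (0:ℝ) 1, psi r (y - x) * Φ (x + s • (y - x)) := by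
        refine setLIntegral_mono' hDm (fun y hy => ?_)
        have : y - x ∈ ball (0:E3) r := by
          have := hDr hy
          rwa [mem_ball_zero_iff, ← dist_eq_norm]
        rw [psi, indicator_of_mem this]
        exact ftc_line hg hD hx hy
    _ ≤ ∫⁻ y, ∫⁻ s in Ioo (0:ℝ) 1, psi r (y - x) * Φ (x + s • (y - x)) :=
        setLIntegral_le_lintegral _ _
    _ = ∫⁻ w, ∫⁻ s in Ioo (0:ℝ) 1, psi r w * Φ (x + s • w) := by
        rw [← lintegral_add_left_eq_self _ x]
        simp
    _ = ∫⁻ s in Ioo (0:ℝ) 1, ∫⁻ w, psi r w * Φ (x + s • w) := by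
        rw [lintegral_lintegral_swap]
        refine Measurable.aemeasurable ?_
        refine (hψ.comp measurable_fst).mul (hΦm.comp ?_)
        fun_prop
    _ = ∫⁻ s in Ioo (0:ℝ) 1, ∫⁻ z, ENNReal.ofReal ((s^3)⁻¹) * psi r (s⁻¹ • z) * Φ (x + z) := by
        refine setLIntegral_congr_fun measurableSet_Ioo (fun s hs => ?_)
        have hm : Measurable fun z : E3 => psi r (s⁻¹ • z) * Φ (x + z) :=
          (hψ.comp (by fun_prop)).mul (hΦm.comp (by fun_prop))
        have := lint_scale (fun z => psi r (s⁻¹ • z) * Φ (x + z)) hm hs.1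
        simp only [smul_smul, inv_mul_cancel₀ hs.1.ne', one_smul] at this
        simp only [this, mul_assoc]
        rw [lintegral_const_mul _ hm]
    _ = ∫⁻ z, ∫⁻ s in Ioo (0:ℝ) 1, ENNReal.ofReal ((s^3)⁻¹) * psi r (s⁻¹ • z) * Φ (x + z) := by
        rw [lintegral_lintegral_swap]
        refine Measurable.aemeasurable ?_
        refine Measurable.mul (Measurable.mul (by fun_prop) (hψ.comp ?_)) (hΦm.comp (by fun_prop))
        exact (measurable_fst.inv).smul measurable_snd
    _ ≤ ∫⁻ z, ENNReal.ofReal (r^3/3) * (K3 r x (x + z) * Φ (x + z)) := by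
        refine lintegral_mono (fun z => ?_)
        rw [lintegral_mul_const _ (by
          refine Measurable.mul (by fun_prop) (hψ.comp ?_)
          exact (measurable_id.inv).smul measurable_const), ← mul_assoc]
        gcongr
        refine (psi_inner hr z).trans (le_of_eq ?_)
        simp [K3, indicator]
    _ = _ := by
        rw [lintegral_add_left_eq_self (fun z => ENNReal.ofReal (r^3/3) * (K3 r x z * Φ z)) x,
          lintegral_const_mul _ (f := fun z => K3 r x z * Φ z) ((measurable_K3 r x).mul hΦm)]

def v3 : ℝ≥0∞ := volume (ball (0:E3) 1)

theorem v3_pos : v3 ≠ 0 := (measure_ball_pos _ _ one_pos).ne'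
theorem v3_top : v3 ≠ ⊤ := measure_ball_lt_top.ne
theorem v3_inv_top : v3⁻¹ ≠ ⊤ := ENNReal.inv_ne_top.2 v3_pos

theorem vol_ball3 (x : E3) {r : ℝ} (hr : 0 ≤ r) :
    volume (ball x r) = ENNReal.ofReal (r^3) * v3 := by
  have := Measure.addHaar_ball (volume : Measure E3) x hr
  rw [this, v3]; simp

theorem cancel_vol {r : ℝ} (hr : 0 < r) {X Y : ℝ≥0∞}
    (h : ENNReal.ofReal (r^3) * v3 * X ≤ ENNReal.ofReal (r^3) * Y) : X ≤ v3⁻¹ * Y := by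
  have h0 : ENNReal.ofReal (r^3) ≠ 0 := by
    have : 0 < r^3 := by positivity
    simpa using this
  rw [mul_assoc] at h
  have h2 : v3 * X ≤ Y := (ENNReal.mul_le_mul_iff_right h0 ENNReal.ofReal_ne_top).1 h
  calc X = v3⁻¹ * (v3 * X) := by
        rw [← mul_assoc, ENNReal.inv_mul_cancel v3_pos v3_top, one_mul]
    _ ≤ v3⁻¹ * Y := by gcongr

/-- the gradient cut off to a set -/
def Gr (D : Set E3) (g : E3 → ℝ) : E3 → ℝ≥0∞ :=
  D.indicator (fun z => ENNReal.ofReal ‖fderiv ℝ g z‖)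

def Va (D : Set E3) (g : E3 → ℝ) : E3 → ℝ≥0∞ :=
  D.indicator (fun z => ENNReal.ofReal |g z|)

theorem measurable_Gr {g : E3 → ℝ} (hg : ContDiff ℝ 1 g) {D : Set E3} (hDm : MeasurableSet D) :
    Measurable (Gr D g) := by
  refine Measurable.indicator ?_ hDm
  have := (hg.continuous_fderiv (by norm_num)).measurable
  fun_prop

theorem measurable_Va {g : E3 → ℝ} (hg : ContDiff ℝ 1 g) {D : Set E3} (hDm : MeasurableSet D) :
    Measurable (Va D g) := by
  refine Measurable.indicator ?_ hDm
  have := hg.continuous.measurable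
  fun_prop

theorem repr1 {g : E3 → ℝ} (hg : ContDiff ℝ 1 g) {R : ℝ} (hR : 0 < R)
    (h0 : ∫ y in ball (0:E3) R, g y = 0) {x : E3} (hx : x ∈ ball (0:E3) R) :
    ENNReal.ofReal |g x| ≤ v3⁻¹ * (ENNReal.ofReal (8/3) *
      ∫⁻ z, K3 (2*R) x z * Gr (ball 0 R) g z) := by
  have ho := osc hg (convex_ball (0:E3) R) measurableSet_ball hx (r := 2*R) (by linarith) (by
    intro y hy
    rw [mem_ball] at *
    calc dist y x ≤ dist y 0 + dist x 0 := dist_triangle_right _ _ _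
      _ < 2 * R := by linarith)
  have hint : IntegrableOn g (ball (0:E3) R) :=
    (hg.continuous.continuousOn.integrableOn_compact (isCompact_closedBall 0 R)).mono_set
      ball_subset_closedBall
  refine cancel_vol hR ?_
  rw [← vol_ball3 0 hR.le]
  calc volume (ball (0:E3) R) * ENNReal.ofReal |g x|
      = ENNReal.ofReal |∫ y in ball (0:E3) R, (g x - g y)| := by
        have : IsFiniteMeasure ((volume : Measure E3).restrict (ball (0:E3) R)) :=
          ⟨by rw [Measure.restrict_apply_univ]; exact measure_ball_lt_top⟩
        rw [integral_sub (integrable_const _) hint, h0, sub_zero, setIntegral_const, smul_eq_mul,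
          abs_mul, abs_of_nonneg measureReal_nonneg, ENNReal.ofReal_mul measureReal_nonneg,
          measureReal_def, ENNReal.ofReal_toReal measure_ball_lt_top.ne]
    _ ≤ ∫⁻ y in ball (0:E3) R, ENNReal.ofReal |g x - g y| := by
        rw [← Real.norm_eq_abs, ofReal_norm]
        refine (enorm_integral_le_lintegral_enorm _).trans (le_of_eq ?_)
        simp_rw [← Real.norm_eq_abs, ofReal_norm]
    _ ≤ _ := ho
    _ = _ := by
        rw [← mul_assoc, ← ENNReal.ofReal_mul (by positivity)]
        rw [show (2*R)^3/3 = R^3 * (8/3) by ring]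
        rfl

theorem repr2 {g : E3 → ℝ} (hg : ContDiff ℝ 1 g) {x : E3} {D : Set E3} (hDm : MeasurableSet D)
    {r : ℝ} (hr : 0 < r) (hD : ball x r ⊆ D) :
    ENNReal.ofReal |g x| ≤ v3⁻¹ *
      ∫⁻ z, K3 r x z * (Gr D g z + ENNReal.ofReal (1/r) * Va D g z) := by
  have hxm : x ∈ ball x r := mem_ball_self hr
  have ho := osc hg (convex_ball x r) measurableSet_ball hxm hr subset_rfl
  have hK := measurable_K3 r x
  have hG := measurable_Gr hg hDm
  have hV := measurable_Va hg hDm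
  have hgm := hg.continuous.measurable
  refine cancel_vol hr ?_
  rw [← vol_ball3 x hr.le]
  have hpos : (0:ℝ) < r^3 := by positivity
  calc volume (ball x r) * ENNReal.ofReal |g x| = ∫⁻ y in ball x r, ENNReal.ofReal |g x| := by
        rw [setLIntegral_const, mul_comm]
    _ ≤ ∫⁻ y in ball x r, (ENNReal.ofReal |g x - g y| + ENNReal.ofReal |g y|) := by
        refine lintegral_mono (fun y => ?_)
        rw [← ENNReal.ofReal_add (abs_nonneg _) (abs_nonneg _)]
        refine ENNReal.ofReal_le_ofReal ?_
        have := abs_add_le (g x - g y) (g y)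
        simpa using this
    _ = (∫⁻ y in ball x r, ENNReal.ofReal |g x - g y|) + ∫⁻ y in ball x r, ENNReal.ofReal |g y| := by
        rw [lintegral_add_right _ (by fun_prop)]
    _ ≤ ENNReal.ofReal (r^3) * (∫⁻ z, K3 r x z * Gr D g z) +
        ENNReal.ofReal (r^3) * ∫⁻ z, K3 r x z * (ENNReal.ofReal (1/r) * Va D g z) := by
        refine add_le_add (ho.trans ?_) ?_
        · refine mul_le_mul' (ENNReal.ofReal_le_ofReal (by linarith)) (lintegral_mono fun z => ?_)
          refine mul_le_mul' le_rfl ?_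
          exact indicator_le_indicator_of_subset hD (fun _ => zero_le) z
        · rw [← lintegral_const_mul _ (by fun_prop), ← lintegral_indicator measurableSet_ball]
          refine lintegral_mono fun z => ?_
          by_cases hz : z ∈ ball x r
          swap
          · rw [indicator_of_notMem hz]; exact zero_le
          rw [indicator_of_mem hz, Va, indicator_of_mem (hD hz), ← mul_assoc, ← mul_assoc]
          refine le_mul_of_one_le_left' ?_
          rw [K3, indicator_of_mem hz]
          have h1 : ENNReal.ofReal r ^ (-(2:ℝ)) ≤ ENNReal.ofReal (dist z x) ^ (-(2:ℝ)) := by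
            rw [ENNReal.rpow_neg, ENNReal.rpow_neg]
            refine ENNReal.inv_le_inv.2 ?_
            exact ENNReal.rpow_le_rpow (ENNReal.ofReal_le_ofReal (mem_ball.1 hz).le) (by norm_num)
          calc (1:ℝ≥0∞) = ENNReal.ofReal (r^3) * ENNReal.ofReal r ^ (-(2:ℝ)) * ENNReal.ofReal (1/r) := by
                rw [ENNReal.ofReal_rpow_of_pos hr, ← ENNReal.ofReal_mul hpos.le,
                  ← ENNReal.ofReal_mul (by positivity), Real.rpow_neg hr.le,
                  show (2:ℝ) = ((2:ℕ):ℝ) by norm_num, Real.rpow_natCast]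
                rw [show r^3 * (r^2)⁻¹ * (1/r) = 1 by field_simp]; simp
            _ ≤ _ := by gcongr
    _ = _ := by
        rw [← mul_add, ← lintegral_add_left (by fun_prop)]
        simp_rw [mul_add]

/-- the L2 norm of the gradient -/
def gr2 (D : Set E3) (g : E3 → ℝ) : ℝ≥0∞ :=
  (∫⁻ x in D, (ENNReal.ofReal ‖fderiv ℝ g x‖) ^ 2) ^ ((1:ℝ)/2)

theorem Gr_l2 {D : Set E3} (hD : MeasurableSet D) (g : E3 → ℝ) :
    (∫⁻ x, (Gr D g x) ^ 2) ^ ((1:ℝ)/2) = gr2 D g := by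
  rw [gr2, ← lintegral_indicator hD]
  congr 2; ext x
  by_cases h : x ∈ D <;> simp [Gr, h]

theorem Va_l2 {D : Set E3} (hD : MeasurableSet D) (g : E3 → ℝ) :
    (∫⁻ x, (Va D g x) ^ 2) ^ ((1:ℝ)/2) = l2On D g := by
  rw [l2On, ← lintegral_indicator hD]
  congr 2; ext x
  by_cases h : x ∈ D <;> simp [Va, h]

theorem poincare : ∃ C : ℝ≥0∞, C ≠ ⊤ ∧ ∀ R : ℝ, 0 < R → ∀ g : E3 → ℝ, ContDiff ℝ 1 g →
    (∫ y in ball (0:E3) R, g y = 0) →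
    l2On (ball 0 R) g ≤ C * ENNReal.ofReal R * gr2 (ball 0 R) g := by
  obtain ⟨C, hC, h⟩ := conv_bd (q1 := 2) (q2 := 2) (q3 := 2) (θ := 0) le_rfl le_rfl le_rfl
    (by norm_num) (by norm_num)
  refine ⟨C * ENNReal.ofReal 2 * (v3⁻¹ * ENNReal.ofReal (8/3)), ?_, ?_⟩
  · exact ENNReal.mul_ne_top (ENNReal.mul_ne_top hC ENNReal.ofReal_ne_top)
      (ENNReal.mul_ne_top v3_inv_top ENNReal.ofReal_ne_top)
  intro R hR g hg h0
  have hVm := measurable_Va hg (measurableSet_ball (x := (0:E3)) (ε := R))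
  have hGm := measurable_Gr hg (measurableSet_ball (x := (0:E3)) (ε := R))
  have := h (2*R) (by linarith) (fun y => (v3⁻¹ * ENNReal.ofReal (8/3)) * Gr (ball 0 R) g y)
    (hGm.const_mul _) (Va (ball 0 R) g) (by
      intro x
      by_cases hx : x ∈ ball (0:E3) R
      swap
      · rw [Va, indicator_of_notMem hx]; exact zero_le
      rw [Va, indicator_of_mem hx]
      refine (repr1 hg hR h0 hx).trans (le_of_eq ?_)
      rw [← mul_assoc, ← lintegral_const_mul _ (f := fun z => K3 (2*R) x z * Gr (ball 0 R) g z)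
        ((measurable_K3 _ _).mul hGm)]
      refine lintegral_congr fun z => ?_
      ring)
  rw [AN_two hVm, l2_pull _ _ hGm, Va_l2 measurableSet_ball, Gr_l2 measurableSet_ball] at this
  refine this.trans (le_of_eq ?_)
  rw [sub_zero, ENNReal.rpow_one, ENNReal.ofReal_mul (by norm_num)]
  ring

theorem lint_ball_fin {h : E3 → ℝ} (hh : Continuous h) (R : ℝ) :
    (∫⁻ x in ball (0:E3) R, (ENNReal.ofReal |h x|) ^ 2) ^ ((1:ℝ)/2) ≠ ⊤ := by
  refine ENNReal.rpow_ne_top_of_nonneg (by norm_num) ?_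
  have hc : Continuous fun x => |h x| ^ 2 := by fun_prop
  have : IntegrableOn (fun x => |h x| ^ 2) (ball (0:E3) R) :=
    (hc.continuousOn.integrableOn_compact (isCompact_closedBall 0 R)).mono_set
      ball_subset_closedBall
  have h2 := this.lintegral_lt_top
  simp_rw [ENNReal.ofReal_pow (abs_nonneg _)] at h2
  exact h2.ne

theorem l2On_fin {g : E3 → ℝ} (hg : ContDiff ℝ 1 g) (R : ℝ) : l2On (ball 0 R) g ≠ ⊤ :=
  lint_ball_fin hg.continuous R

theorem gr2_fin {g : E3 → ℝ} (hg : ContDiff ℝ 1 g) (R : ℝ) : gr2 (ball 0 R) g ≠ ⊤ := by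
  have := lint_ball_fin (h := fun x => ‖fderiv ℝ g x‖)
    (hg.continuous_fderiv (by norm_num)).norm R
  simp only [abs_norm] at this
  exact this

theorem aniso_zero {q1 q2 q3 : ℝ} (hq1 : 2 ≤ q1) (hq2 : 2 ≤ q2) (hq3 : 2 ≤ q3) {g : E3 → ℝ}
    {D : Set E3} (h : ∀ x ∈ D, g x = 0) : anisoNorm q1 q2 q3 D g = 0 := by
  have h' : ∀ x, D.indicator g x = 0 := by
    intro x
    by_cases hx : x ∈ D
    · rw [indicator_of_mem hx, h x hx]
    · rw [indicator_of_notMem hx]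
  have p1 : 0 < q1 := by linarith
  have p2 : 0 < q2 := by linarith
  have p3 : 0 < q3 := by linarith
  have p21 : 0 < q2 / q1 := by positivity
  have p32 : 0 < q3 / q2 := by positivity
  have p33 : 0 < 1 / q3 := by positivity
  simp only [anisoNorm, h', abs_zero, ENNReal.ofReal_zero, ENNReal.zero_rpow_of_pos p1,
    lintegral_zero, ENNReal.zero_rpow_of_pos p21, ENNReal.zero_rpow_of_pos p32,
    ENNReal.zero_rpow_of_pos p33]

theorem l2On_zero {g : E3 → ℝ} (hg : ContDiff ℝ 1 g) {R : ℝ} (h : l2On (ball 0 R) g = 0) :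
    ∀ x ∈ ball (0:E3) R, g x = 0 := by
  rw [l2On, ENNReal.rpow_eq_zero_iff_of_pos (by norm_num)] at h
  have hgm := hg.continuous.measurable
  rw [lintegral_eq_zero_iff (by fun_prop)] at h
  have : g =ᵐ[volume.restrict (ball (0:E3) R)] fun _ => (0:ℝ) := by
    filter_upwards [h] with x hx
    simpa using hx
  exact Measure.eqOn_open_of_ae_eq this isOpen_ball hg.continuous.continuousOn continuousOn_const

theorem l2_add {f g : E3 → ℝ≥0∞} (hf : Measurable f) (hg : Measurable g) :
    (∫⁻ x, (f x + g x) ^ 2) ^ ((1:ℝ)/2)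
      ≤ (∫⁻ x, (f x) ^ 2) ^ ((1:ℝ)/2) + (∫⁻ x, (g x) ^ 2) ^ ((1:ℝ)/2) := by
  have := ENNReal.lintegral_Lp_add_le (μ := (volume : Measure E3)) (p := 2) hf.aemeasurable
    hg.aemeasurable (by norm_num)
  simpa using this

theorem single {q1 q2 q3 θ : ℝ} (hq1 : 2 ≤ q1) (hq2 : 2 ≤ q2) (hq3 : 2 ≤ q3)
    (hθ : θ + (1/q1 + 1/q2 + 1/q3) = 3/2) (hθ1 : θ ≤ 1) :
    ∃ C : ℝ≥0∞, C ≠ ⊤ ∧ ∀ ρ : ℝ, 0 < ρ → ∀ g : E3 → ℝ, ContDiff ℝ 1 g →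
      (∫ y in ball (0:E3) (Real.sqrt 2 * ρ), g y = 0) →
      anisoNorm q1 q2 q3 (ball 0 ρ) g ≤ C * gr2 (ball 0 (Real.sqrt 2 * ρ)) g ^ θ
        * l2On (ball 0 (Real.sqrt 2 * ρ)) g ^ (1 - θ) := by
  obtain ⟨Cp, hCp, hP⟩ := poincare
  obtain ⟨C, hC, h⟩ := conv_bd hq1 hq2 hq3 hθ hθ1
  set K : ℝ := Cp.toReal + 1 with hK
  have hKp : 0 < K := by positivity
  have hCK : Cp ≤ ENNReal.ofReal K := by
    rw [← ENNReal.ofReal_toReal hCp]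
    exact ENNReal.ofReal_le_ofReal (by linarith)
  have hs2 : 1 < Real.sqrt 2 := by
    rw [Real.lt_sqrt (by norm_num)]; norm_num
  set c : ℝ := (Real.sqrt 2 - 1) / (K * Real.sqrt 2) with hc
  have hcp : 0 < c := div_pos (by linarith) (by positivity)
  refine ⟨C * v3⁻¹ * ENNReal.ofReal (c ^ (1-θ) * (1 + 1/c)),
    ENNReal.mul_ne_top (ENNReal.mul_ne_top hC v3_inv_top) ENNReal.ofReal_ne_top, ?_⟩
  intro ρ hρ g hg h0
  set D := ball (0:E3) (Real.sqrt 2 * ρ) with hD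
  have hDm : MeasurableSet D := measurableSet_ball
  have hpo := hP (Real.sqrt 2 * ρ) (by positivity) g hg h0
  have hPf : gr2 D g ≠ ⊤ := gr2_fin hg _
  have hSf : l2On D g ≠ ⊤ := l2On_fin hg _
  rw [← hD] at hpo
  have hsub : ball (0:E3) ρ ⊆ D := ball_subset_ball (by nlinarith)
  rcases eq_or_ne (l2On D g) 0 with hS0 | hS0
  · have := l2On_zero hg hS0
    rw [aniso_zero hq1 hq2 hq3 (fun x hx => this x (hsub hx))]
    exact zero_le
  have hP0 : gr2 D g ≠ 0 := by
    intro hz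
    rw [hz, mul_zero] at hpo
    exact hS0 (le_antisymm hpo zero_le)
  set p := (gr2 D g).toReal with hp
  set s := (l2On D g).toReal with hs
  have hpp : 0 < p := ENNReal.toReal_pos hP0 hPf
  have hsp : 0 < s := ENNReal.toReal_pos hS0 hSf
  have hPe : gr2 D g = ENNReal.ofReal p := (ENNReal.ofReal_toReal hPf).symm
  have hSe : l2On D g = ENNReal.ofReal s := (ENNReal.ofReal_toReal hSf).symm
  have hsle : s ≤ K * (Real.sqrt 2 * ρ) * p := by
    have : ENNReal.ofReal s ≤ ENNReal.ofReal (K * (Real.sqrt 2 * ρ) * p) := by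
      rw [ENNReal.ofReal_mul (by positivity), ENNReal.ofReal_mul hKp.le, ← hPe, ← hSe]
      refine hpo.trans ?_
      gcongr
    exact (ENNReal.ofReal_le_ofReal_iff (by positivity)).1 this
  set r : ℝ := c * s / p with hr
  have hrp : 0 < r := by positivity
  have hrle : r ≤ (Real.sqrt 2 - 1) * ρ := by
    rw [hr, div_le_iff₀ hpp]
    calc c * s ≤ c * (K * (Real.sqrt 2 * ρ) * p) := by gcongr
      _ = _ := by rw [hc]; field_simp
  have hGm := measurable_Gr hg hDm
  have hVm := measurable_Va hg hDm
  have hHm : Measurable fun z => Gr D g z + ENNReal.ofReal (1/r) * Va D g z := by fun_prop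
  have key := h r hrp (fun z => v3⁻¹ * (Gr D g z + ENNReal.ofReal (1/r) * Va D g z))
    (hHm.const_mul _) (fun x => ENNReal.ofReal |(ball (0:E3) ρ).indicator g x|) (by
      intro x
      by_cases hx : x ∈ ball (0:E3) ρ
      swap
      · simp [indicator_of_notMem hx]
      rw [indicator_of_mem hx]
      refine (repr2 hg hDm hrp (x := x) (D := D) ?_).trans (le_of_eq ?_)
      · refine ball_subset_ball' ?_
        have := mem_ball.1 hx
        nlinarith
      · rw [← lintegral_const_mul _
          (f := fun z => K3 r x z * (Gr D g z + ENNReal.ofReal (1/r) * Va D g z))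
          ((measurable_K3 _ _).mul hHm)]
        refine lintegral_congr fun z => ?_
        ring)
  have hA : anisoNorm q1 q2 q3 (ball 0 ρ) g
      = AN q1 q2 q3 (fun x => ENNReal.ofReal |(ball (0:E3) ρ).indicator g x|) := rfl
  rw [hA]
  refine key.trans ?_
  rw [l2_pull _ _ hHm]
  have hl2 : (∫⁻ z, (Gr D g z + ENNReal.ofReal (1/r) * Va D g z) ^ 2) ^ ((1:ℝ)/2)
      ≤ ENNReal.ofReal ((1 + 1/c) * p) := by
    refine (l2_add hGm (hVm.const_mul _)).trans (le_of_eq ?_)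
    rw [l2_pull _ _ hVm, Gr_l2 hDm, Va_l2 hDm, hPe, hSe, ← ENNReal.ofReal_mul (by positivity),
      ← ENNReal.ofReal_add hpp.le (by positivity)]
    congr 1
    rw [hr]; field_simp
  calc C * ENNReal.ofReal r ^ (1 - θ) *
        (v3⁻¹ * (∫⁻ z, (Gr D g z + ENNReal.ofReal (1/r) * Va D g z) ^ 2) ^ ((1:ℝ)/2))
      ≤ C * ENNReal.ofReal r ^ (1 - θ) * (v3⁻¹ * ENNReal.ofReal ((1 + 1/c) * p)) := by gcongr
    _ = C * v3⁻¹ * (ENNReal.ofReal r ^ (1 - θ) * ENNReal.ofReal ((1 + 1/c) * p)) := by ring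
    _ = C * v3⁻¹ * (ENNReal.ofReal (c ^ (1-θ) * (1 + 1/c)) * (ENNReal.ofReal p ^ θ *
          ENNReal.ofReal s ^ (1 - θ))) := by
        rw [ENNReal.ofReal_rpow_of_pos hrp, ENNReal.ofReal_rpow_of_pos hpp,
          ENNReal.ofReal_rpow_of_pos hsp, ← ENNReal.ofReal_mul (by positivity),
          ← ENNReal.ofReal_mul (by positivity), ← ENNReal.ofReal_mul (by positivity)]
        congr 2
        rw [hr, Real.div_rpow (by positivity) hpp.le, Real.mul_rpow hcp.le hsp.le]
        have hpθ : p ^ (1 - θ) * p ^ θ = p := by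
          rw [← Real.rpow_add hpp]; simp
        have : p ^ (1-θ) ≠ 0 := (Real.rpow_pos_of_pos hpp _).ne'
        rw [div_mul_eq_mul_div, div_eq_iff this]
        calc c ^ (1 - θ) * s ^ (1 - θ) * ((1 + 1 / c) * p)
            = c ^ (1 - θ) * s ^ (1 - θ) * ((1 + 1 / c) * (p ^ (1 - θ) * p ^ θ)) := by rw [hpθ]
          _ = _ := by ring
    _ = _ := by rw [hPe, hSe]; ring

theorem clm_expand (L : E3 →L[ℝ] ℝ) :
    L = ∑ i : Fin 3, L (EuclideanSpace.single i 1) • (EuclideanSpace.proj i : E3 →L[ℝ] ℝ) := by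
  ext x
  have hx : x = ∑ i : Fin 3, x i • EuclideanSpace.single i (1:ℝ) := by
    ext j
    simp [Finset.sum_apply, Pi.single_apply]
  conv_lhs => rw [hx]
  simp [map_sum, mul_comm]

theorem meas_grad {f : E3 → ℝ → ℝ} (hf : Measurable (Function.uncurry f))
    (hs : ∀ t : ℝ, ContDiff ℝ 1 (fun x => f x t)) :
    Measurable fun p : ℝ × E3 => ‖fderiv ℝ (fun y => f y p.1) p.2‖ := by
  have hv : ∀ v : E3, Measurable fun p : ℝ × E3 => fderiv ℝ (fun y => f y p.1) p.2 v := by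
    intro v
    refine measurable_of_tendsto_metrizable
      (f := fun (n : ℕ) (p : ℝ × E3) => (n:ℝ) • (f (p.2 + (n:ℝ)⁻¹ • v) p.1 - f p.2 p.1)) ?_ ?_
    · intro n
      have h1 : Measurable fun p : ℝ × E3 => f (p.2 + (n:ℝ)⁻¹ • v) p.1 :=
        hf.comp (g := Function.uncurry f) (f := fun p : ℝ × E3 => (p.2 + (n:ℝ)⁻¹ • v, p.1)) (by fun_prop)
      have h2 : Measurable fun p : ℝ × E3 => f p.2 p.1 :=
        hf.comp (g := Function.uncurry f) (f := fun p : ℝ × E3 => (p.2, p.1)) (by fun_prop)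
      simp only [smul_eq_mul]
      exact (h1.sub h2).const_mul _
    · rw [tendsto_pi_nhds]
      intro p
      have hd : HasFDerivAt (fun y => f y p.1) (fderiv ℝ (fun y => f y p.1) p.2) p.2 :=
        ((hs p.1).differentiable (by norm_num) _).hasFDerivAt
      exact hd.lim v (by
        have : Tendsto (fun n : ℕ => (n:ℝ)) atTop atTop := tendsto_natCast_atTop_atTop
        exact tendsto_norm_atTop_atTop.comp this)
  have hψ : Continuous fun a : Fin 3 → ℝ =>
      ‖∑ i : Fin 3, a i • (EuclideanSpace.proj i : E3 →L[ℝ] ℝ)‖ := by fun_prop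
  have := hψ.measurable.comp (measurable_pi_lambda
    (fun (p : ℝ × E3) (i : Fin 3) => fderiv ℝ (fun y => f y p.1) p.2 (EuclideanSpace.single i 1))
    (fun i => hv _))
  convert this using 2 with p
  simp only [Function.comp]
  rw [← clm_expand]

theorem final_fin {f : E3 → ℝ → ℝ} {I I' : Set ℝ} (hI : I ⊆ I') {M θ : ℝ} (hM : 2 ≤ M)
    (hθ : θ = 2 / M) {A P S : ℝ → ℝ≥0∞} {C : ℝ≥0∞} (hC : C ≠ ⊤) (hC0 : C ≠ 0)
    (hP : Measurable P) (hS : ∀ t, S t ≠ ⊤)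
    (h : ∀ᵐ t ∂(volume.restrict I'), A t ≤ C * (P t ^ ((1:ℝ)/2)) ^ θ * S t ^ (1 - θ)) :
    (∫⁻ t in I, A t ^ M) ^ (1 / M) ≤ C * ((∫⁻ t in I', P t) ^ ((1:ℝ)/2)) ^ θ
      * essSup S (volume.restrict I') ^ (1 - θ) := by
  have hM0 : 0 < M := by linarith
  have hθ0 : 0 < θ := by rw [hθ]; positivity
  have hθ1 : θ ≤ 1 := by rw [hθ, div_le_one hM0]; exact hM
  have hIm : (∫⁻ t in I, A t ^ M) ≤ ∫⁻ t in I', A t ^ M := lintegral_mono_set hI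
  refine (ENNReal.rpow_le_rpow hIm (by positivity)).trans ?_
  set T := ∫⁻ t in I', P t with hT
  set Z := essSup S (volume.restrict I') with hZ
  rcases eq_or_ne T 0 with hT0 | hT0
  · have hz : ∫⁻ t in I', A t ^ M = 0 := by
      have h1 := (lintegral_eq_zero_iff hP).1 hT0
      rw [← lintegral_zero (μ := volume.restrict I')]
      refine lintegral_congr_ae ?_
      filter_upwards [h, h1] with t ht h1t
      have : P t = 0 := h1t
      rw [this, ENNReal.zero_rpow_of_pos (by norm_num), ENNReal.zero_rpow_of_pos hθ0, mul_zero,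
        zero_mul] at ht
      have : A t = 0 := le_antisymm ht zero_le
      rw [this, ENNReal.zero_rpow_of_pos hM0]
    rw [hz, ENNReal.zero_rpow_of_pos (by positivity)]
    exact zero_le
  have hTe : (T ^ ((1:ℝ)/2)) ^ θ = T ^ (1/M) := by
    rw [← ENNReal.rpow_mul, hθ]; congr 1; field_simp
  rw [hTe]
  rcases eq_or_ne (Z ^ (1 - θ)) ⊤ with hZt | hZt
  · rw [hZt, ENNReal.mul_top]
    · exact le_top
    · refine mul_ne_zero hC0 ?_
      rw [Ne, ENNReal.rpow_eq_zero_iff_of_pos (by positivity)]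
      exact hT0
  have hK : (C * Z ^ (1 - θ)) ^ M ≠ ⊤ :=
    ENNReal.rpow_ne_top_of_nonneg hM0.le (ENNReal.mul_ne_top hC hZt)
  calc (∫⁻ t in I', A t ^ M) ^ (1 / M)
      ≤ (∫⁻ t in I', (C * Z ^ (1 - θ)) ^ M * P t) ^ (1 / M) := by
        refine ENNReal.rpow_le_rpow (lintegral_mono_ae ?_) (by positivity)
        filter_upwards [h, ENNReal.ae_le_essSup S] with t ht hst
        have e : P t = (P t ^ (1/M)) ^ M := by
          rw [← ENNReal.rpow_mul, one_div_mul_cancel hM0.ne', ENNReal.rpow_one]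
        have e2 : (P t ^ ((1:ℝ)/2)) ^ θ = P t ^ (1/M) := by
          rw [← ENNReal.rpow_mul, hθ]; congr 1; field_simp
        rw [e2] at ht
        conv_rhs => rw [e]
        rw [← ENNReal.mul_rpow_of_nonneg _ _ hM0.le]
        refine ENNReal.rpow_le_rpow (ht.trans ?_) hM0.le
        rw [mul_right_comm]
        gcongr
    _ = C * T ^ (1 / M) * Z ^ (1 - θ) := by
        rw [lintegral_const_mul' _ _ hK, ENNReal.mul_rpow_of_nonneg _ _ (by positivity),
          ← ENNReal.rpow_mul, mul_one_div_cancel hM0.ne', ENNReal.rpow_one]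
        ring

/-- The space-time consequence of (2.7): for `q_j ∈ [2,∞)` and `m ∈ [2,∞]` with
`2/m + 1/q̄ = 3/2`, and `f` smooth in space with spatial mean zero on `B(√2ϱ)` for a.e. `t`:
`‖f‖_{L^m_t L^{q⃗}_x(Q(ϱ))} ≤ C ‖∇f‖_{L²(Q(√2ϱ))}^{2/m} ‖f‖_{L^∞_t L²_x(Q(√2ϱ))}^{1−2/m}`. -/
theorem aniso_sobolev_spacetime
    (q1 q2 q3 : ℝ) (hq1 : 2 ≤ q1) (hq2 : 2 ≤ q2) (hq3 : 2 ≤ q3)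
    (m : ℝ≥0∞) (hm : 2 ≤ m)
    (hmq : 2 / m.toReal + (1/q1 + 1/q2 + 1/q3) = 3/2) :
    ∃ C : ℝ, 0 < C ∧
      ∀ (ϱ : ℝ), 0 < ϱ → ∀ f : E3 → ℝ → ℝ,
        Measurable (Function.uncurry f) →
        (∀ t : ℝ, ContDiff ℝ (⊤ : ℕ∞) (fun x => f x t)) →
        (∀ᵐ t ∂(volume.restrict (Ioo (-((Real.sqrt 2 * ϱ)^2)) 0)),
          (∫ x in ball (0 : E3) (Real.sqrt 2 * ϱ), f x t) = 0) →
        mixedNorm m q1 q2 q3 ϱ f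
          ≤ ENNReal.ofReal C
              * ((∫⁻ t in Ioo (-((Real.sqrt 2 * ϱ)^2)) 0,
                    ∫⁻ x in ball (0 : E3) (Real.sqrt 2 * ϱ),
                      (ENNReal.ofReal ‖fderiv ℝ (fun y => f y t) x‖) ^ 2) ^ ((1:ℝ)/2))
                  ^ (2 / m.toReal)
              * (essSup (fun t => l2On (ball (0 : E3) (Real.sqrt 2 * ϱ)) (fun x => f x t))
                    (volume.restrict (Ioo (-((Real.sqrt 2 * ϱ)^2)) 0)))
                  ^ (1 - 2 / m.toReal) := by
  have hθ1 : 2 / m.toReal ≤ 1 := by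
    rcases eq_or_ne m ⊤ with rfl | hmt
    · simp
    · have : 2 ≤ m.toReal := by
        have := ENNReal.toReal_mono hmt hm
        simpa using this
      rw [div_le_one (by linarith)]; exact this
  obtain ⟨C, hC, h⟩ := single hq1 hq2 hq3 hmq hθ1
  have hCle : C ≤ ENNReal.ofReal (C.toReal + 1) := by
    conv_lhs => rw [← ENNReal.ofReal_toReal hC]
    exact ENNReal.ofReal_le_ofReal (by linarith)
  have hCpos : 0 < C.toReal + 1 := by positivity
  refine ⟨C.toReal + 1, hCpos, ?_⟩
  intro ρ hρ f hfm hfs hf0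
  have hfs1 : ∀ t, ContDiff ℝ 1 (fun x => f x t) := fun t => (hfs t).of_le (by
    exact_mod_cast le_top)
  have hsub : Ioo (-(ρ^2)) 0 ⊆ Ioo (-((Real.sqrt 2 * ρ)^2)) 0 := by
    refine Ioo_subset_Ioo_left ?_
    rw [mul_pow, Real.sq_sqrt (by norm_num)]
    nlinarith [sq_nonneg ρ]
  have hae : ∀ᵐ t ∂(volume.restrict (Ioo (-((Real.sqrt 2 * ρ)^2)) 0)),
      anisoNorm q1 q2 q3 (ball (0 : E3) ρ) (fun x => f x t)
        ≤ ENNReal.ofReal (C.toReal + 1) * gr2 (ball 0 (Real.sqrt 2 * ρ)) (fun x => f x t)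
            ^ (2 / m.toReal)
          * l2On (ball 0 (Real.sqrt 2 * ρ)) (fun x => f x t) ^ (1 - 2 / m.toReal) := by
    filter_upwards [hf0] with t ht
    refine (h ρ hρ _ (hfs1 t) ht).trans ?_
    gcongr
  by_cases hmt : m = ⊤
  · rw [mixedNorm, if_pos hmt]
    subst hmt
    simp only [ENNReal.toReal_top, _root_.div_zero, ENNReal.rpow_zero, mul_one, _root_.sub_zero,
      ENNReal.rpow_one] at hae ⊢
    refine essSup_le_of_ae_le _ ?_
    refine ae_mono (Measure.restrict_mono hsub le_rfl) ?_
    filter_upwards [hae, ENNReal.ae_le_essSup (μ := volume.restrict (Ioo (-((Real.sqrt 2 * ρ)^2)) 0))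
      (fun t => l2On (ball (0 : E3) (Real.sqrt 2 * ρ)) (fun x => f x t))] with t h1 h2
    exact h1.trans (by gcongr)
  · rw [mixedNorm, if_neg hmt]
    have hM : 2 ≤ m.toReal := by
      have := ENNReal.toReal_mono hmt hm
      simpa using this
    refine final_fin (f := f) hsub hM rfl ENNReal.ofReal_ne_top (by simpa using hCpos) ?_ ?_ hae
    · have hg := meas_grad hfm hfs1
      have hg2 : Measurable fun p : ℝ × E3 =>
          (ENNReal.ofReal ‖fderiv ℝ (fun y => f y p.1) p.2‖) ^ 2 := hg.ennreal_ofReal.pow_const 2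
      exact hg2.lintegral_prod_right'
    · intro t
      exact l2On_fin (hfs1 t) _
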